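/- (Estimate (3.16).) Let N ≥ 2 and N ≤ p < 2N − 1. There exists C > 0, depending only on N, p and the Littlewood–Paley function, such that for every u ∈ C_c^∞((0,∞)×ℝ^N; ℝ^N), the ℝ^N-valued function g with components g_j(t,y) := ∑_{i=1}^N P_{ji}(t,y) u_i(t,y) satisfies ‖∂_t g‖_{L¹(ℝ₊;Ḃ^{−1+N/p}_{p,1}(ℝ^N))} ≤ C ( ∑_{r=1}^{N−1} E(u)^r ) ‖∂_t u‖_{L¹(ℝ₊;Ḃ^{−1+N/p}_{p,1}(ℝ^N))}. -/

import Mathlib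

open MeasureTheory
open scoped BigOperators ENNReal

noncomputable section

namespace MHD

/-- A Littlewood–Paley function on a finite-dimensional real inner product space:
a nonnegative, smooth, radial, radially nonincreasing function equal to `1` on the unit
ball and supported in the ball of radius `2`. -/
structure LPF (V : Type*) [NormedAddCommGroup V] [InnerProductSpace ℝ V]
    [FiniteDimensional ℝ V] [MeasurableSpace V] [BorelSpace V] where
  chi : V → ℝ
  smooth : ContDiff ℝ (⊤ : ℕ∞) chi
  nonneg : ∀ x, 0 ≤ chi x
  radial : ∀ x y : V, ‖x‖ = ‖y‖ → chi x = chi y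
  radial_antitone : ∀ x y : V, ‖x‖ ≤ ‖y‖ → chi y ≤ chi x
  eq_one : ∀ x : V, ‖x‖ ≤ 1 → chi x = 1
  supp : ∀ x : V, 2 ≤ ‖x‖ → chi x = 0

variable {V : Type*} [NormedAddCommGroup V] [InnerProductSpace ℝ V]
    [FiniteDimensional ℝ V] [MeasurableSpace V] [BorelSpace V]

/-- `φ̂(ξ) = χ̂(ξ/2) − χ̂(ξ)`. -/
def LPF.phiHat (χ : LPF V) (ξ : V) : ℝ := χ.chi ((2 : ℝ)⁻¹ • ξ) - χ.chi ξ

/-- The `k`-th homogeneous Littlewood–Paley block `Δ̇_k f = 𝓕⁻¹(φ̂(2^{-k}·)·𝓕f)`. -/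
def LPF.block (χ : LPF V) (k : ℤ) (f : V → ℂ) : V → ℂ :=
  FourierTransformInv.fourierInv
    (fun ξ : V => ((χ.phiHat ((2 : ℝ) ^ (-k) • ξ) : ℝ) : ℂ) * FourierTransform.fourier f ξ)

/-- The `k`-th Littlewood–Paley kernel `𝓕⁻¹(φ̂(2^{-k}·))`. -/
def LPF.kernel (χ : LPF V) (k : ℤ) : V → ℂ :=
  FourierTransformInv.fourierInv (fun ξ : V => ((χ.phiHat ((2 : ℝ) ^ (-k) • ξ) : ℝ) : ℂ))

/-- The homogeneous Besov norm `‖f‖_{Ḃ^s_{p,1}} = ∑_{k∈ℤ} 2^{sk} ‖Δ̇_k f‖_{L^p} ∈ [0,∞]`. -/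
def besov (χ : LPF V) (s p : ℝ) (f : V → ℂ) : ℝ≥0∞ :=
  ∑' k : ℤ, ENNReal.ofReal ((2 : ℝ) ^ (s * (k : ℝ))) *
    eLpNorm (χ.block k f) (ENNReal.ofReal p) volume

/-- The space-time norm `∫_I ‖u(t,·)‖_{Ḃ^s_{p,1}} dt ∈ [0,∞]`. -/
def besovT (χ : LPF V) (s p : ℝ) (I : Set ℝ) (u : ℝ → V → ℂ) : ℝ≥0∞ :=
  ∫⁻ t in I, besov χ s p (u t)

/-- Euclidean space `ℝ^n`. -/
abbrev Euc (n : ℕ) := EuclideanSpace ℝ (Fin n)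

/-- Partial derivative `∂_i f` in the `i`-th coordinate direction. -/
def pdv {n : ℕ} {F : Type*} [NormedAddCommGroup F] [NormedSpace ℝ F]
    (i : Fin n) (f : Euc n → F) (y : Euc n) : F :=
  fderiv ℝ f y (EuclideanSpace.single i 1)

/-- `u ∈ C_c^∞((0,∞) × ℝ^N ; F)`. -/
def SmoothCpt (N : ℕ) {F : Type*} [NormedAddCommGroup F] [NormedSpace ℝ F]
    (u : ℝ → Euc N → F) : Prop :=
  ContDiff ℝ (⊤ : ℕ∞) (Function.uncurry u) ∧ HasCompactSupport (Function.uncurry u) ∧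
    ∀ t : ℝ, t ≤ 0 → ∀ y, u t y = 0

/-- `Q` is the family of cofactor polynomials: `Q i j` has zero constant term and
`adjugate (1 + M) i j = δ_{ij} + (Q i j)(M)` for every real `N × N` matrix `M`. -/
def IsCofactorPoly (N : ℕ) (Q : Fin N → Fin N → MvPolynomial (Fin N × Fin N) ℝ) : Prop :=
  ∀ i j : Fin N,
    MvPolynomial.constantCoeff (Q i j) = 0 ∧
    ∀ M : Matrix (Fin N) (Fin N) ℝ,
      Matrix.adjugate (1 + M) i j =
        (if i = j then (1 : ℝ) else 0) +
          MvPolynomial.eval (fun v : Fin N × Fin N => M v.1 v.2) (Q i j)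

/-- The matrix field `P_{ij}(t,y) = Q_{ij}(∫₀ᵗ Du(τ,y) dτ)`. -/
def Pmat {N : ℕ} (Q : Fin N → Fin N → MvPolynomial (Fin N × Fin N) ℝ)
    (u : ℝ → Euc N → Euc N) (t : ℝ) (y : Euc N) (i j : Fin N) : ℝ :=
  MvPolynomial.eval
    (fun v : Fin N × Fin N => ∫ τ in (0 : ℝ)..t, pdv v.2 (fun z => u τ z v.1) y) (Q i j)

/-- `E(u) = ‖D²u‖_{L¹(ℝ₊; Ḃ^s_{p,1}(ℝ^N))}`, summed over all components and all pairs of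
spatial derivatives. -/
def EE {N : ℕ} (χ : LPF (Euc N)) (s p : ℝ) (u : ℝ → Euc N → Euc N) : ℝ≥0∞ :=
  ∑ m : Fin N, ∑ i : Fin N, ∑ j : Fin N,
    besovT χ s p (Set.Ioi 0) (fun t y => ((pdv i (pdv j fun z => u t z m) y : ℝ) : ℂ))

/-- `‖∂_t u‖_{L¹(ℝ₊; Ḃ^s_{p,1}(ℝ^N))}`, summed over components. -/
def dtNorm {N : ℕ} (χ : LPF (Euc N)) (s p : ℝ) (u : ℝ → Euc N → Euc N) : ℝ≥0∞ :=
  ∑ m : Fin N,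
    besovT χ s p (Set.Ioi 0) (fun t y => ((deriv (fun τ => u τ y m) t : ℝ) : ℂ))

end MHD

set_option linter.unusedSectionVars false

namespace MHD

theorem ennreal_rpow_le_of_le_mul_rpow {p q : ℝ} (hpq : p.HolderConjugate q) {I R : ℝ≥0∞}
    (hI : I ≠ ⊤) (h : I ≤ R * I ^ (1 / q)) : I ≤ R ^ p := by
  rcases eq_or_ne I 0 with h0 | h0
  · simp [h0]
  have h1 : I ^ (1 / p) ≤ R := by
    have hq : I ^ (1 / q) ≠ 0 := by simp [h0, hI]
    have hq' : I ^ (1 / q) ≠ ⊤ := ENNReal.rpow_ne_top_of_nonneg (by simpa using hpq.symm.nonneg) hI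
    have h2 : I = I ^ (1 / p) * I ^ (1 / q) := by
      rw [← ENNReal.rpow_add _ _ h0 hI, one_div, one_div, hpq.inv_add_inv_eq_one,
        ENNReal.rpow_one]
    rw [← ENNReal.mul_le_mul_iff_left hq hq', ← h2]
    exact h
  calc I = (I ^ (1 / p)) ^ p := by
        rw [← ENNReal.rpow_mul, one_div, inv_mul_cancel₀ hpq.ne_zero, ENNReal.rpow_one]
    _ ≤ R ^ p := ENNReal.rpow_le_rpow h1 hpq.nonneg

/-- **Minkowski's integral inequality.** -/
theorem lintegral_lintegral_rpow_le {α β : Type*} [MeasurableSpace α] [MeasurableSpace β]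
    {μ : Measure α} {ν : Measure β} [SigmaFinite μ] [SFinite ν] {F : β → α → ℝ≥0∞}
    (hF : Measurable (Function.uncurry F)) {p : ℝ} (hp : 1 < p) :
    (∫⁻ x, (∫⁻ t, F t x ∂ν) ^ p ∂μ) ^ (1 / p) ≤ ∫⁻ t, (∫⁻ x, F t x ^ p ∂μ) ^ (1 / p) ∂ν := by
  obtain ⟨q, hpq⟩ : ∃ q, p.HolderConjugate q := ⟨_, Real.HolderConjugate.conjExponent hp⟩
  set R := ∫⁻ t, (∫⁻ x, F t x ^ p ∂μ) ^ (1 / p) ∂ν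
  set H : α → ℝ≥0∞ := fun x => ∫⁻ t, F t x ∂ν with hH
  have hHm : Measurable H := by
    have : Measurable (Function.uncurry fun x t => F t x) := hF.comp measurable_swap
    exact this.lintegral_prod_right'
  set G : ℕ → α → ℝ≥0∞ := fun n => (spanningSets μ n).indicator fun x => min (H x) n with hG
  have hGm : ∀ n, Measurable (G n) := fun n =>
    (hHm.min measurable_const).indicator (measurableSet_spanningSets μ n)
  have hGH : ∀ n x, G n x ≤ H x := fun n x => by
    by_cases hx : x ∈ spanningSets μ n <;> simp [hG, hx]
  have hGp : ∀ n, ∫⁻ x, G n x ^ p ∂μ ≤ R ^ p := by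
    intro n
    refine ennreal_rpow_le_of_le_mul_rpow hpq (ne_of_lt ?_) ?_
    · calc ∫⁻ x, G n x ^ p ∂μ ≤ ∫⁻ x, (spanningSets μ n).indicator (fun _ => (n : ℝ≥0∞) ^ p) x ∂μ := by
            refine lintegral_mono fun x => ?_
            by_cases hx : x ∈ spanningSets μ n
            · simp only [hG, hx, Set.indicator_of_mem]
              exact ENNReal.rpow_le_rpow (min_le_right _ _) hpq.nonneg
            · simp [hG, hx, hpq.pos]
        _ = (n : ℝ≥0∞) ^ p * μ (spanningSets μ n) := by
            rw [lintegral_indicator (measurableSet_spanningSets μ n)]; simp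
        _ < ⊤ := ENNReal.mul_lt_top (ENNReal.rpow_lt_top_of_nonneg hpq.nonneg (by simp))
            (measure_spanningSets_lt_top μ n)
    · calc ∫⁻ x, G n x ^ p ∂μ ≤ ∫⁻ x, ∫⁻ t, F t x * G n x ^ (p - 1) ∂ν ∂μ := by
            refine lintegral_mono fun x => ?_
            rw [lintegral_mul_const _ (show Measurable fun t => F t x from
              hF.comp measurable_prodMk_right)]
            calc G n x ^ p = G n x * G n x ^ (p - 1) := by
                  nth_rw 2 [← ENNReal.rpow_one (G n x)]
                  rw [← ENNReal.rpow_add_of_nonneg _ _ zero_le_one (by linarith),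
                    add_sub_cancel]
              _ ≤ _ := by gcongr; exact hGH n x
        _ = ∫⁻ t, ∫⁻ x, F t x * G n x ^ (p - 1) ∂μ ∂ν := by
            refine lintegral_lintegral_swap (Measurable.aemeasurable ?_)
            exact (hF.comp measurable_swap).mul
              (((hGm n).pow_const _).comp measurable_fst)
        _ ≤ ∫⁻ t, (∫⁻ x, F t x ^ p ∂μ) ^ (1 / p) * (∫⁻ x, G n x ^ p ∂μ) ^ (1 / q) ∂ν := by
            refine lintegral_mono fun t => ?_
            have := ENNReal.lintegral_mul_le_Lp_mul_Lq μ hpq (f := F t)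
              (g := fun x => G n x ^ (p - 1)) (hF.comp measurable_prodMk_left).aemeasurable
              ((hGm n).pow_const _).aemeasurable
            refine this.trans (le_of_eq ?_)
            congr 3
            ext x
            rw [← ENNReal.rpow_mul, hpq.sub_one_mul_conj]
        _ = R * (∫⁻ x, G n x ^ p ∂μ) ^ (1 / q) := by
            rw [lintegral_mul_const]
            exact ((hF.pow_const p).lintegral_prod_right').pow_const _
  have hmono : Monotone fun n x => G n x ^ p := by
    intro n m hnm x
    refine ENNReal.rpow_le_rpow ?_ hpq.nonneg
    by_cases hx : x ∈ spanningSets μ n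
    · have hx' : x ∈ spanningSets μ m := monotone_spanningSets μ hnm hx
      simp only [hG, hx, hx', Set.indicator_of_mem]
      exact min_le_min le_rfl (by exact_mod_cast hnm)
    · simp [hG, hx]
  have hsup : ∀ x, H x ^ p ≤ ⨆ n, G n x ^ p := by
    intro x
    obtain ⟨n₀, hn₀⟩ : ∃ n, x ∈ spanningSets μ n := by
      exact Set.mem_iUnion.1 ((iUnion_spanningSets μ).ge (Set.mem_univ x))
    have key : H x ≤ ⨆ n, G n x := by
      refine le_of_forall_lt fun c hc => ?_
      obtain ⟨m, hm⟩ := ENNReal.exists_nat_gt (ne_top_of_lt hc)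
      refine lt_of_lt_of_le ?_ (le_iSup _ (max m n₀))
      have hx : x ∈ spanningSets μ (max m n₀) := monotone_spanningSets μ (le_max_right _ _) hn₀
      simp only [hG, hx, Set.indicator_of_mem]
      refine lt_min hc (hm.trans_le ?_)
      exact_mod_cast le_max_left m n₀
    calc H x ^ p ≤ (⨆ n, G n x) ^ p := ENNReal.rpow_le_rpow key hpq.nonneg
      _ = ⨆ n, G n x ^ p := by
        exact (ENNReal.orderIsoRpow p hpq.pos).map_iSup fun n => G n x
  calc (∫⁻ x, H x ^ p ∂μ) ^ (1 / p) ≤ (R ^ p) ^ (1 / p) := by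
        refine ENNReal.rpow_le_rpow ?_ (by simpa using hpq.nonneg)
        calc ∫⁻ x, H x ^ p ∂μ ≤ ∫⁻ x, ⨆ n, G n x ^ p ∂μ := lintegral_mono hsup
          _ = ⨆ n, ∫⁻ x, G n x ^ p ∂μ := lintegral_iSup (fun n => (hGm n).pow_const _) hmono
          _ ≤ R ^ p := iSup_le hGp
    _ = R := by rw [← ENNReal.rpow_mul, one_div, mul_inv_cancel₀ hpq.ne_zero, ENNReal.rpow_one]

/-- Minkowski's integral inequality for vector-valued functions, `1 ≤ p < ∞`. -/
theorem eLpNorm_integral_le {α β : Type*} [MeasurableSpace α] [MeasurableSpace β]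
    {μ : Measure α} {ν : Measure β} [SigmaFinite μ] [SFinite ν] {F : β → α → ℂ}
    (hF : Measurable (Function.uncurry F)) {p : ℝ} (hp : 1 ≤ p) :
    eLpNorm (fun x => ∫ t, F t x ∂ν) (ENNReal.ofReal p) μ ≤
      ∫⁻ t, eLpNorm (F t) (ENNReal.ofReal p) μ ∂ν := by
  have hp0 : ENNReal.ofReal p ≠ 0 := by simp; linarith
  simp only [eLpNorm_eq_lintegral_rpow_enorm_toReal hp0 ENNReal.ofReal_ne_top,
    ENNReal.toReal_ofReal (zero_le_one.trans hp)]
  calc (∫⁻ x, ‖∫ t, F t x ∂ν‖ₑ ^ p ∂μ) ^ (1 / p)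
      ≤ (∫⁻ x, (∫⁻ t, ‖F t x‖ₑ ∂ν) ^ p ∂μ) ^ (1 / p) := by
        gcongr with x
        exact enorm_integral_le_lintegral_enorm _
    _ ≤ _ := by
      rcases hp.eq_or_lt with rfl | hp
      · simp only [ENNReal.rpow_one, one_div, inv_one]
        rw [lintegral_lintegral_swap]
        exact (hF.comp measurable_swap).enorm.aemeasurable
      · exact lintegral_lintegral_rpow_le (F := fun t x => ‖F t x‖ₑ) hF.enorm hp

variable {V : Type*} [NormedAddCommGroup V] [InnerProductSpace ℝ V]
    [FiniteDimensional ℝ V] [MeasurableSpace V] [BorelSpace V]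

theorem eLpNorm_comp_sub_smul {h : V → ℂ} (hh : Continuous h) (x : V) {c : ℝ} (hc : 0 < c)
    {r : ℝ} (hr : 0 < r) :
    eLpNorm (fun z => h (x - c • z)) (ENNReal.ofReal r) volume =
      ENNReal.ofReal (c ^ (-(Module.finrank ℝ V : ℝ) / r)) *
        eLpNorm h (ENNReal.ofReal r) volume := by
  have h1 : eLpNorm (fun z => h (x - c • z)) (ENNReal.ofReal r) volume =
      eLpNorm (fun y => h (x - y)) (ENNReal.ofReal r)
        (Measure.map (fun z : V => c • z) volume) := by
    rw [eLpNorm_map_measure (by fun_prop) (by fun_prop)]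
    rfl
  have h2 : eLpNorm (fun y => h (x - y)) (ENNReal.ofReal r) volume =
      eLpNorm h (ENNReal.ofReal r) volume :=
    eLpNorm_comp_measurePreserving (f := fun y => x - y) hh.aestronglyMeasurable
      (Measure.measurePreserving_sub_left volume x)
  rw [h1, Measure.map_addHaar_smul _ hc.ne', eLpNorm_smul_measure_of_ne_top (by simp), h2,
    smul_eq_mul]
  congr 1
  have h3 : 0 < (c ^ Module.finrank ℝ V)⁻¹ := by positivity
  rw [abs_of_pos h3, ENNReal.toReal_div, ENNReal.toReal_ofReal hr.le, ENNReal.toReal_one,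
    ENNReal.ofReal_rpow_of_pos h3, ← Real.rpow_natCast, ← Real.rpow_neg hc.le,
    ← Real.rpow_mul hc.le]
  congr 2
  ring

open scoped SchwartzMap FourierTransform NNReal ContDiff Topology LineDeriv
open SchwartzMap Filter

section Multipliers

variable {V : Type*} [NormedAddCommGroup V] [InnerProductSpace ℝ V]
    [FiniteDimensional ℝ V] [MeasurableSpace V] [BorelSpace V]

/-- The dilated symbol `ξ ↦ m(2^{-k} ξ)`. -/
def dilSymb (m : 𝓢(V, ℂ)) (k : ℤ) (ξ : V) : ℂ := m ((2 : ℝ) ^ (-k) • ξ)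

theorem dilSymb_hasTemperateGrowth (m : 𝓢(V, ℂ)) (k : ℤ) :
    (dilSymb m k).HasTemperateGrowth :=
  m.hasTemperateGrowth.comp
    (((2 : ℝ) ^ (-k) • ContinuousLinearMap.id ℝ V).hasTemperateGrowth)

/-- The convolution kernel of the Fourier multiplier with symbol `m`. -/
def ker (m : 𝓢(V, ℂ)) : 𝓢(V, ℂ) := 𝓕⁻ m

/-- The Fourier multiplier `m(2^{-k} D)`. -/
def mult (m : 𝓢(V, ℂ)) (k : ℤ) : 𝓢(V, ℂ) →L[ℂ] 𝓢(V, ℂ) := fourierMultiplierCLM ℂ (dilSymb m k)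

theorem fourier_mult (m : 𝓢(V, ℂ)) (k : ℤ) (h : 𝓢(V, ℂ)) (ξ : V) :
    𝓕 (mult m k h) ξ = dilSymb m k ξ * 𝓕 h ξ := by
  simp [mult, fourierMultiplierCLM_apply, smulLeftCLM_apply_apply (dilSymb_hasTemperateGrowth m k)]

theorem mult_apply (m : 𝓢(V, ℂ)) (k : ℤ) (h : 𝓢(V, ℂ)) (x : V) :
    mult m k h x = ∫ z, ker m z * h (x - (2 : ℝ) ^ (-k) • z) := by
  set c : ℝ := (2 : ℝ) ^ (-k)
  have key := VectorFourier.integral_fourierIntegral_smul_eq_flip (e := Real.fourierChar)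
    (μ := (volume : Measure V)) (ν := (volume : Measure V)) (L := c • innerₗ V)
    (f := ker m) (g := fun η => (Real.fourierChar (inner ℝ η x) : ℂ) * 𝓕 h η)
    Real.continuous_fourierChar
    (by simp only [LinearMap.smul_apply, innerₗ_apply_apply]; fun_prop) (ker m).integrable ?_
  swap
  · refine ((𝓕 h).integrable).bdd_mul (c := 1) ?_ ?_
    · exact (by fun_prop : Continuous fun η : V =>
        (Real.fourierChar (inner ℝ η x) : ℂ)).aestronglyMeasurable
    · exact Filter.Eventually.of_forall fun η => (Circle.norm_coe _).le
  have h1 : ∀ η : V, VectorFourier.fourierIntegral Real.fourierChar volume (c • innerₗ V)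
      (ker m) η = m (c • η) := by
    intro η
    have : m (c • η) = 𝓕 (ker m) (c • η) := by simp [ker]
    rw [this, fourier_coe, Real.fourier_eq, VectorFourier.fourierIntegral]
    congr 1
    ext v
    simp [inner_smul_right]
  have h2 : ∀ z : V, VectorFourier.fourierIntegral Real.fourierChar volume (c • innerₗ V).flip
      (fun η => (Real.fourierChar (inner ℝ η x) : ℂ) * 𝓕 h η) z = h (x - c • z) := by
    intro z
    have : h (x - c • z) = 𝓕⁻ (𝓕 h) (x - c • z) := by simp
    rw [this, fourierInv_coe, Real.fourierInv_eq, VectorFourier.fourierIntegral]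
    congr 1
    ext η
    rw [Circle.smul_def, Circle.smul_def, smul_eq_mul, smul_eq_mul, ← mul_assoc, ← Circle.coe_mul,
      ← AddChar.map_add_eq_mul]
    congr 3
    simp [inner_sub_right, inner_smul_right, real_inner_comm]
    ring
  simp only [h1, h2, smul_eq_mul] at key
  rw [← key]
  have : mult m k h x = 𝓕⁻ (𝓕 (mult m k h)) x := by simp
  rw [this, fourierInv_coe, Real.fourierInv_eq]
  congr 1
  ext η
  rw [fourier_mult, Circle.smul_def, smul_eq_mul, dilSymb]
  ring

theorem eLpNorm_mult_le (m : 𝓢(V, ℂ)) {r : ℝ} (hr : 1 ≤ r) (k : ℤ) (h : 𝓢(V, ℂ)) :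
    eLpNorm (mult m k h) (ENNReal.ofReal r) volume ≤
      eLpNorm (ker m) 1 volume * eLpNorm h (ENNReal.ofReal r) volume := by
  have : (mult m k h : V → ℂ) = fun x => ∫ z, ker m z * h (x - (2 : ℝ) ^ (-k) • z) :=
    funext (mult_apply m k h)
  rw [this]
  refine (eLpNorm_integral_le (F := fun z x => ker m z * h (x - (2 : ℝ) ^ (-k) • z))
    ?_ hr).trans (le_of_eq ?_)
  · refine Continuous.measurable ?_
    simp only [Function.uncurry_def]
    have := (ker m).continuous
    have := h.continuous
    fun_prop
  · have h2 : ∀ z, eLpNorm (fun x => ker m z * h (x - (2 : ℝ) ^ (-k) • z)) (ENNReal.ofReal r)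
        volume = ‖ker m z‖ₑ * eLpNorm h (ENNReal.ofReal r) volume := by
      intro z
      have h3 := eLpNorm_const_smul (ker m z) (fun x => h (x - (2 : ℝ) ^ (-k) • z))
        (ENNReal.ofReal r) volume
      have h4 := eLpNorm_comp_measurePreserving (p := ENNReal.ofReal r)
        (h.continuous.aestronglyMeasurable (μ := (volume : Measure V)))
        (measurePreserving_sub_right volume ((2 : ℝ) ^ (-k) • z))
      rw [← h4]
      exact h3
    simp only [h2]
    rw [lintegral_mul_const _ (ker m).continuous.enorm.measurable, eLpNorm_one_eq_lintegral_enorm]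

theorem two_zpow_rpow (k : ℤ) (a : ℝ) : ((2 : ℝ) ^ (-k)) ^ (-a) = (2 : ℝ) ^ ((k : ℝ) * a) := by
  rw [← Real.rpow_intCast, ← Real.rpow_mul (by norm_num)]
  congr 1
  push_cast
  ring

theorem exists_coe_eq {a : ℝ≥0∞} (h : a ≠ ⊤) : ∃ c : ℝ≥0, (c : ℝ≥0∞) = a :=
  ⟨a.toNNReal, ENNReal.coe_toNNReal h⟩

theorem exists_enorm_mult_le (m : 𝓢(V, ℂ)) {r : ℝ} (hr : 1 ≤ r) :
    ∃ C : ℝ≥0, ∀ (k : ℤ) (h : 𝓢(V, ℂ)) (x : V), ‖mult m k h x‖ₑ ≤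
      C * ENNReal.ofReal ((2 : ℝ) ^ (k * (Module.finrank ℝ V / r))) *
        eLpNorm h (ENNReal.ofReal r) volume := by
  have hr' : 1 ≤ ENNReal.ofReal r := by simpa using hr
  have := ENNReal.HolderConjugate.conjExponent hr'
  obtain ⟨C, hC⟩ := exists_coe_eq
    ((ker m).memLp (ENNReal.ofReal r).conjExponent volume).2.ne
  refine ⟨C, fun k h x => ?_⟩
  rw [hC, mult_apply]
  have h1 := eLpNorm_smul_le_mul_eLpNorm (μ := (volume : Measure V))
    (p := (ENNReal.ofReal r).conjExponent) (q := ENNReal.ofReal r) (r := 1)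
    (φ := ker m) (f := fun z => h (x - (2 : ℝ) ^ (-k) • z))
    (Continuous.aestronglyMeasurable (by have := h.continuous; fun_prop))
    (ker m).continuous.aestronglyMeasurable (hpqr := this.symm)
  rw [eLpNorm_comp_sub_smul h.continuous x (by positivity) (by linarith), neg_div,
    two_zpow_rpow, eLpNorm_one_eq_lintegral_enorm, ← mul_assoc] at h1
  exact (enorm_integral_le_lintegral_enorm _).trans h1

theorem eLpNorm_le_of_enorm_le {F : V → ℂ} {p : ℝ} (hp : 0 < p) {B : ℝ≥0∞}
    (hB : ∀ x, ‖F x‖ₑ ≤ B) (hF : Continuous F) :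
    eLpNorm F (ENNReal.ofReal p) volume ≤
      B ^ (1 / 2 : ℝ) * eLpNorm F (ENNReal.ofReal (p / 2)) volume ^ (1 / 2 : ℝ) := by
  have hp0 : ENNReal.ofReal p ≠ 0 := by simpa using hp
  have hp1 : ENNReal.ofReal (p / 2) ≠ 0 := by simpa using hp
  rw [eLpNorm_eq_lintegral_rpow_enorm_toReal hp0 ENNReal.ofReal_ne_top,
    eLpNorm_eq_lintegral_rpow_enorm_toReal hp1 ENNReal.ofReal_ne_top,
    ENNReal.toReal_ofReal hp.le, ENNReal.toReal_ofReal (by positivity)]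
  calc (∫⁻ x, ‖F x‖ₑ ^ p) ^ (1 / p)
      ≤ (∫⁻ x, B ^ (p / 2) * ‖F x‖ₑ ^ (p / 2)) ^ (1 / p) := by
        gcongr with x
        calc ‖F x‖ₑ ^ p = ‖F x‖ₑ ^ (p / 2) * ‖F x‖ₑ ^ (p / 2) := by
              rw [← ENNReal.rpow_add_of_nonneg _ _ (by positivity) (by positivity), add_halves]
          _ ≤ _ := by gcongr; exact hB x
    _ = _ := by
        rw [lintegral_const_mul _ (hF.enorm.measurable.pow_const _),
          ENNReal.mul_rpow_of_nonneg _ _ (by positivity), ← ENNReal.rpow_mul, ← ENNReal.rpow_mul]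
        congr 2 <;> field_simp

theorem exists_eLpNorm_mult_le_half (m : 𝓢(V, ℂ)) {p : ℝ} (hp : 2 ≤ p) :
    ∃ C : ℝ≥0, ∀ (k : ℤ) (h : 𝓢(V, ℂ)), eLpNorm (mult m k h) (ENNReal.ofReal p) volume ≤
      C * ENNReal.ofReal ((2 : ℝ) ^ (k * (Module.finrank ℝ V / p))) *
        eLpNorm h (ENNReal.ofReal (p / 2)) volume := by
  obtain ⟨C₁, hC₁⟩ := exists_enorm_mult_le m (r := p / 2) (by linarith)
  obtain ⟨C₂, hC₂⟩ := exists_coe_eq ((ker m).memLp 1 volume).2.ne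
  refine ⟨C₁ ^ (1 / 2 : ℝ) * C₂ ^ (1 / 2 : ℝ), fun k h => ?_⟩
  refine (eLpNorm_le_of_enorm_le (by linarith) (hC₁ k h) (mult m k h).continuous).trans ?_
  have h2 := eLpNorm_mult_le m (r := p / 2) (by linarith) k h
  rw [← hC₂] at h2
  set N := eLpNorm h (ENNReal.ofReal (p / 2)) volume
  calc _ ≤ (C₁ * ENNReal.ofReal ((2 : ℝ) ^ (k * (Module.finrank ℝ V / (p / 2)))) * N) ^ (1 / 2 : ℝ)
        * (C₂ * N) ^ (1 / 2 : ℝ) := by gcongr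
    _ = (C₁ : ℝ≥0∞) ^ (1 / 2 : ℝ) * (C₂ : ℝ≥0∞) ^ (1 / 2 : ℝ) *
        ENNReal.ofReal ((2 : ℝ) ^ (k * (Module.finrank ℝ V / (p / 2)))) ^ (1 / 2 : ℝ) *
          (N ^ (1 / 2 : ℝ) * N ^ (1 / 2 : ℝ)) := by
        rw [ENNReal.mul_rpow_of_nonneg _ _ (by positivity),
          ENNReal.mul_rpow_of_nonneg _ _ (by positivity),
          ENNReal.mul_rpow_of_nonneg _ _ (by positivity)]
        ring
    _ = _ := by
        rw [← ENNReal.rpow_add_of_nonneg _ _ (by positivity) (by positivity),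
          ENNReal.ofReal_rpow_of_pos (by positivity), ← Real.rpow_mul (by norm_num)]
        push_cast
        rw [ENNReal.coe_rpow_of_nonneg _ (by positivity),
          ENNReal.coe_rpow_of_nonneg _ (by positivity)]
        have h3 : (k : ℝ) * (Module.finrank ℝ V / (p / 2)) * (1 / 2) =
            k * (Module.finrank ℝ V / p) := by field_simp
        rw [h3]
        norm_num

end Multipliers

section Blocks

variable {V : Type*} [NormedAddCommGroup V] [InnerProductSpace ℝ V]
    [FiniteDimensional ℝ V] [MeasurableSpace V] [BorelSpace V]

theorem mult_mult_eq_self {m m' : 𝓢(V, ℂ)} (hm : ∀ ξ, m' ξ * m ξ = m ξ) (k : ℤ)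
    (h : 𝓢(V, ℂ)) : mult m' k (mult m k h) = mult m k h := by
  have : 𝓕 (mult m' k (mult m k h)) = 𝓕 (mult m k h) := by
    ext ξ
    rw [fourier_mult, fourier_mult, ← mul_assoc, dilSymb, dilSymb, hm]
  simpa using congrArg (fun g : 𝓢(V, ℂ) => 𝓕⁻ g) this

theorem mult_eq_zero {m : 𝓢(V, ℂ)} {k : ℤ} {h : 𝓢(V, ℂ)}
    (H : ∀ ξ, m ((2 : ℝ) ^ (-k) • ξ) = 0 ∨ 𝓕 h ξ = 0) : mult m k h = 0 := by
  have : 𝓕 (mult m k h) = 0 := by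
    ext ξ
    rw [fourier_mult, dilSymb]
    rcases H ξ with h0 | h0 <;> rw [h0] <;> simp
  have h2 := congrArg (fun g : 𝓢(V, ℂ) => 𝓕⁻ g) this
  simpa using h2

/-- The pointwise product of two Schwartz functions. -/
def sprod (f g : 𝓢(V, ℂ)) : 𝓢(V, ℂ) := pairing (ContinuousLinearMap.mul ℂ ℂ) f g

@[simp] theorem sprod_apply (f g : 𝓢(V, ℂ)) (x : V) : sprod f g x = f x * g x := by
  simp [sprod]

theorem fourierInv_eq_fourier_neg' (f : 𝓢(V, ℂ)) (x : V) : 𝓕⁻ f x = 𝓕 f (-x) := by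
  rw [fourierInv_coe, Real.fourierInv_eq_fourier_neg, fourier_coe]

theorem fourier_sprod_eq_zero {f g : 𝓢(V, ℂ)} {ξ : V}
    (H : ∀ η, 𝓕 f η = 0 ∨ 𝓕 g (ξ - η) = 0) : 𝓕 (sprod f g) ξ = 0 := by
  set B := ContinuousLinearMap.mul ℂ ℂ
  have h1 : sprod f g = 𝓕 (convolution B (𝓕⁻ f : 𝓢(V, ℂ)) (𝓕⁻ g : 𝓢(V, ℂ))) := by
    rw [fourier_convolution]
    simp [sprod, B]
  have h2 : ∀ c : 𝓢(V, ℂ), 𝓕 (𝓕 c : 𝓢(V, ℂ)) ξ = c (-ξ) := by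
    intro c
    have : (𝓕⁻ (𝓕 c : 𝓢(V, ℂ)) : 𝓢(V, ℂ)) (-ξ) = 𝓕 (𝓕 c : 𝓢(V, ℂ)) ξ := by
      rw [fourierInv_eq_fourier_neg', neg_neg]
    rw [← this]
    simp
  rw [h1, h2, convolution_apply, MeasureTheory.convolution]
  refine integral_eq_zero_of_ae (Filter.Eventually.of_forall fun η => ?_)
  simp only [B, ContinuousLinearMap.mul_apply', Pi.zero_apply, mul_eq_zero,
    fourierInv_eq_fourier_neg']
  have := H (-η)
  rwa [show -(-ξ - η) = ξ - -η by abel]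

namespace LPF
variable (χ : LPF V)

theorem hasCompactSupport_comp_smul {c : ℝ} (hc : 0 < c) :
    HasCompactSupport fun ξ : V => (χ.chi (c • ξ) : ℂ) := by
  refine HasCompactSupport.intro (isCompact_closedBall (0 : V) (2 / c)) fun ξ hξ => ?_
  rw [χ.supp, Complex.ofReal_zero]
  rw [norm_smul, Real.norm_of_nonneg hc.le]
  simp only [Metric.mem_closedBall, dist_zero_right, not_le, div_lt_iff₀ hc] at hξ
  linarith

theorem contDiff_comp_smul (c : ℝ) : ContDiff ℝ ∞ fun ξ : V => (χ.chi (c • ξ) : ℂ) :=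
  Complex.ofRealCLM.contDiff.comp (χ.smooth.comp (contDiff_const_smul c))

/-- The low-frequency cutoff as a Schwartz function. -/
def low : 𝓢(V, ℂ) :=
  (χ.hasCompactSupport_comp_smul one_pos).toSchwartzMap (χ.contDiff_comp_smul 1)

/-- The symbol of the `0`-th Littlewood–Paley block as a Schwartz function. -/
def phi : 𝓢(V, ℂ) :=
  (χ.hasCompactSupport_comp_smul (c := 2⁻¹) (by norm_num)).toSchwartzMap
    (χ.contDiff_comp_smul 2⁻¹) - χ.low

/-- A fattened annular cutoff, equal to one on the support of `phi`. -/
def wide : 𝓢(V, ℂ) :=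
  (χ.hasCompactSupport_comp_smul (c := 4⁻¹) (by norm_num)).toSchwartzMap
    (χ.contDiff_comp_smul 4⁻¹) -
  (χ.hasCompactSupport_comp_smul (c := 2) (by norm_num)).toSchwartzMap (χ.contDiff_comp_smul 2)

theorem low_apply (ξ : V) : χ.low ξ = (χ.chi ξ : ℂ) := by
  change ((χ.chi ((1 : ℝ) • ξ) : ℝ) : ℂ) = _
  rw [one_smul]

theorem phi_apply (ξ : V) : χ.phi ξ = (χ.phiHat ξ : ℂ) := by
  rw [phi, sub_apply, low_apply, phiHat, Complex.ofReal_sub]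
  rfl

theorem wide_apply (ξ : V) : χ.wide ξ = (χ.chi ((4 : ℝ)⁻¹ • ξ) : ℂ) - χ.chi ((2 : ℝ) • ξ) := rfl

theorem phi_eq_zero {ξ : V} (h : ‖ξ‖ ≤ 1 ∨ 4 ≤ ‖ξ‖) : χ.phi ξ = 0 := by
  rw [phi_apply, phiHat]
  have h2 : ‖(2 : ℝ)⁻¹ • ξ‖ = ‖ξ‖ / 2 := by rw [norm_smul]; norm_num; ring
  rcases h with h | h
  · rw [χ.eq_one _ h, χ.eq_one _ (by rw [h2]; linarith)]
    simp
  · rw [χ.supp ξ (by linarith), χ.supp _ (by rw [h2]; linarith)]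
    simp

theorem wide_eq_zero {ξ : V} (h : ‖ξ‖ ≤ 1 / 2) : χ.wide ξ = 0 := by
  rw [wide_apply, χ.eq_one _ (by rw [norm_smul]; norm_num; linarith),
    χ.eq_one _ (by rw [norm_smul]; norm_num; linarith), sub_self]

theorem wide_mul_phi (ξ : V) : χ.wide ξ * χ.phi ξ = χ.phi ξ := by
  by_cases h : ‖ξ‖ ≤ 1 ∨ 4 ≤ ‖ξ‖
  · simp [χ.phi_eq_zero h]
  · push Not at h
    rw [wide_apply, χ.eq_one _ (by rw [norm_smul]; norm_num; linarith),
      χ.supp _ (by rw [norm_smul]; norm_num; linarith)]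
    simp

theorem phi_dilate_eq_zero {k : ℤ} {ξ : V}
    (h : ‖ξ‖ ≤ (2 : ℝ) ^ k ∨ (2 : ℝ) ^ (k + 2) ≤ ‖ξ‖) : χ.phi ((2 : ℝ) ^ (-k) • ξ) = 0 := by
  apply χ.phi_eq_zero
  have h2 : (0 : ℝ) < 2 ^ k := by positivity
  rw [norm_smul, Real.norm_of_nonneg (by positivity), zpow_neg]
  rw [zpow_add₀ (by norm_num)] at h
  refine h.imp (fun h => ?_) fun h => ?_
  · rwa [inv_mul_le_iff₀ h2, mul_one]
  · rw [le_inv_mul_iff₀ h2]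
    linarith

theorem block_eq_mult (k : ℤ) (f : 𝓢(V, ℂ)) : χ.block k f = mult χ.phi k f := by
  have : mult χ.phi k f = 𝓕⁻ (𝓕 (mult χ.phi k f) : 𝓢(V, ℂ)) := by simp
  rw [this, fourierInv_coe, LPF.block]
  congr 1
  ext ξ
  rw [fourier_mult, dilSymb, phi_apply, fourier_coe]

theorem mult_phi_eq_sub (k : ℤ) (f : 𝓢(V, ℂ)) :
    mult χ.phi k f = mult χ.low (k + 1) f - mult χ.low k f := by
  have : 𝓕 (mult χ.phi k f) = 𝓕 (mult χ.low (k + 1) f - mult χ.low k f) := by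
    ext ξ
    rw [show 𝓕 (mult χ.low (k + 1) f - mult χ.low k f) =
      𝓕 (mult χ.low (k + 1) f) - 𝓕 (mult χ.low k f) from map_sub (FourierTransform.fourierCLM ℂ 𝓢(V, ℂ)) _ _,
      sub_apply, fourier_mult, fourier_mult, fourier_mult, ← sub_mul]
    congr 1
    rw [dilSymb, dilSymb, dilSymb, phi_apply, low_apply, low_apply, phiHat, smul_smul,
      Complex.ofReal_sub]
    congr 5
    rw [neg_add, zpow_add₀ (by norm_num), mul_comm]
    norm_num
  simpa using congrArg (fun g : 𝓢(V, ℂ) => 𝓕⁻ g) this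

/-- The partial sums `∑_{-n ≤ k < n} Δ̇_k f` telescope. -/
theorem sum_mult_phi (n : ℕ) (f : 𝓢(V, ℂ)) :
    ∑ k ∈ Finset.Ico (-n : ℤ) n, mult χ.phi k f = mult χ.low n f - mult χ.low (-n) f := by
  induction n with
  | zero => simp
  | succ n ih =>
    have h1 : Finset.Ico (-(n + 1 : ℕ) : ℤ) (n + 1 : ℕ) =
        insert (n : ℤ) (insert (-(n + 1 : ℕ) : ℤ) (Finset.Ico (-n : ℤ) n)) := by
      ext k
      simp only [Finset.mem_Ico, Finset.mem_insert]
      omega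
    rw [h1, Finset.sum_insert, Finset.sum_insert, ih, mult_phi_eq_sub, mult_phi_eq_sub]
    · have : (-(n + 1 : ℕ) : ℤ) + 1 = -n := by push_cast; ring
      rw [this]
      push_cast
      abel
    · simp
    · simp; omega

theorem besov_eq (s p : ℝ) (f : 𝓢(V, ℂ)) : besov χ s p f =
    ∑' k : ℤ, ENNReal.ofReal ((2 : ℝ) ^ (s * (k : ℝ))) *
      eLpNorm (mult χ.phi k f) (ENNReal.ofReal p) volume := by
  simp only [besov, block_eq_mult]

/-- Bernstein's inequality for the blocks. -/
theorem exists_enorm_block_le {p : ℝ} (hp : 1 ≤ p) : ∃ C : ℝ≥0, ∀ (k : ℤ) (f : 𝓢(V, ℂ)) (x : V),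
    ‖mult χ.phi k f x‖ₑ ≤ C * ENNReal.ofReal ((2 : ℝ) ^ (k * (Module.finrank ℝ V / p))) *
        eLpNorm (mult χ.phi k f) (ENNReal.ofReal p) volume := by
  obtain ⟨C, hC⟩ := exists_enorm_mult_le χ.wide hp
  refine ⟨C, fun k f x => ?_⟩
  have := hC k (mult χ.phi k f) x
  rwa [mult_mult_eq_self χ.wide_mul_phi] at this

theorem block_block_mul_eq_zero {j k q : ℤ} (f g : 𝓢(V, ℂ))
    (h : max j k + 3 ≤ q ∨ (j + 3 ≤ k ∧ q + 3 ≤ k) ∨ (k + 3 ≤ j ∧ q + 3 ≤ j)) :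
    mult χ.phi q (sprod (mult χ.phi j f) (mult χ.phi k g)) = 0 := by
  refine mult_eq_zero fun ξ => ?_
  by_contra! H
  obtain ⟨h1, h2⟩ := H
  refine h2 (fourier_sprod_eq_zero fun η => ?_)
  by_contra! H
  obtain ⟨h3, h4⟩ := H
  rw [fourier_mult] at h3 h4
  have a1 := mt χ.phi_dilate_eq_zero h1
  have a3 := mt χ.phi_dilate_eq_zero (left_ne_zero_of_mul h3)
  have a4 := mt χ.phi_dilate_eq_zero (left_ne_zero_of_mul h4)
  push Not at a1 a3 a4
  have t1 := norm_add_le η (ξ - η)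
  have t2 := norm_sub_le ξ (ξ - η)
  have t3 := norm_sub_norm_le ξ η
  rw [add_sub_cancel] at t1
  rw [sub_sub_cancel] at t2
  have t4 : ‖ξ - η‖ ≤ ‖ξ‖ + ‖η‖ := norm_sub_le ξ η
  have mono : ∀ {a b : ℤ}, a ≤ b → (2 : ℝ) ^ a ≤ 2 ^ b := fun h =>
    zpow_le_zpow_right₀ (by norm_num) h
  have dbl : ∀ a : ℤ, (2 : ℝ) ^ (a + 3) = 2 * 2 ^ (a + 2) := fun a => by
    rw [zpow_add₀ (by norm_num), zpow_add₀ (by norm_num)]; norm_num; ring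
  rcases h with h | ⟨h, h'⟩ | ⟨h, h'⟩
  · have := mono (show j + 3 ≤ q by omega)
    have := mono (show k + 3 ≤ q by omega)
    linarith [dbl j, dbl k]
  · have := mono h
    have := mono h'
    linarith [dbl j, dbl q]
  · have := mono h
    have := mono h'
    linarith [dbl k, dbl q]

end LPF

end Blocks

section Convergence

variable {V : Type*} [NormedAddCommGroup V] [InnerProductSpace ℝ V]
    [FiniteDimensional ℝ V] [MeasurableSpace V] [BorelSpace V]

theorem tendsto_mult_apply {ι : Type*} {l : Filter ι} [l.IsCountablyGenerated]
    (m : 𝓢(V, ℂ)) (k : ι → ℤ) (h : ι → 𝓢(V, ℂ)) (x : V) {L : V → ℂ} {B : ℝ}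
    (hB : ∀ i y, ‖h i y‖ ≤ B)
    (hL : ∀ᵐ z, Tendsto (fun i => h i (x - (2 : ℝ) ^ (-k i) • z)) l (𝓝 (L z))) :
    Tendsto (fun i => mult m (k i) (h i) x) l (𝓝 (∫ z, ker m z * L z)) := by
  simp only [mult_apply]
  refine tendsto_integral_filter_of_dominated_convergence (fun z => ‖ker m z‖ * B)
    (Eventually.of_forall fun i => ?_) (Eventually.of_forall fun i => Eventually.of_forall fun z => ?_)
    ((ker m).integrable.norm.mul_const B) ?_
  · exact Continuous.aestronglyMeasurable
      (by have := (ker m).continuous; have := (h i).continuous; fun_prop)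
  · rw [norm_mul]
    gcongr
    exact hB i _
  · filter_upwards [hL] with z hz using hz.const_mul _

theorem norm_mult_le (m : 𝓢(V, ℂ)) (k : ℤ) (h : 𝓢(V, ℂ)) (x : V) {B : ℝ}
    (hB : ∀ y, ‖h y‖ ≤ B) : ‖mult m k h x‖ ≤ (∫ z, ‖ker m z‖) * B := by
  rw [mult_apply, ← integral_mul_const]
  refine norm_integral_le_of_norm_le ((ker m).integrable.norm.mul_const B)
    (Eventually.of_forall fun z => ?_)
  rw [norm_mul]
  gcongr
  exact hB _

namespace LPF
variable (χ : LPF V)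

theorem integral_ker_low : ∫ z, ker χ.low z = 1 := by
  have h1 : 𝓕 (ker χ.low) 0 = χ.low 0 := by simp [ker]
  rw [low_apply, χ.eq_one 0 (by simp), fourier_coe, Real.fourier_eq] at h1
  simpa using h1

theorem tendsto_low_atTop (f : 𝓢(V, ℂ)) (x : V) :
    Tendsto (fun n : ℕ => mult χ.low n f x) atTop (𝓝 (f x)) := by
  have := tendsto_mult_apply (l := atTop) χ.low (fun n : ℕ => (n : ℤ)) (fun _ => f) x
    (L := fun _ => f x) (fun _ y => norm_le_seminorm ℝ f y) ?_
  · rwa [integral_mul_const, integral_ker_low, one_mul] at this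
  · refine Eventually.of_forall fun z => ?_
    have h2 : Tendsto (fun n : ℕ => x - (2 : ℝ) ^ (-(n : ℤ)) • z) atTop (𝓝 (x - (0 : ℝ) • z)) := by
      refine tendsto_const_nhds.sub (Tendsto.smul_const ?_ z)
      have := tendsto_pow_atTop_nhds_zero_of_lt_one (r := (2 : ℝ)⁻¹) (by norm_num) (by norm_num)
      refine this.congr fun n => ?_
      simp
    rw [zero_smul, sub_zero] at h2
    exact (f.continuous.tendsto x).comp h2

theorem tendsto_low_atBot [Nontrivial V] (f : 𝓢(V, ℂ)) (x : V) :
    Tendsto (fun n : ℕ => mult χ.low (-n) f x) atTop (𝓝 0) := by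
  have := tendsto_mult_apply (l := atTop) χ.low (fun n : ℕ => (-n : ℤ)) (fun _ => f) x
    (L := fun _ => 0) (fun _ y => norm_le_seminorm ℝ f y) ?_
  · simpa using this
  · have h0 : ∀ᵐ z : V, z ≠ 0 := by simp [ae_iff, measure_singleton]
    filter_upwards [h0] with z hz
    refine (f.tendsto_cocompact).comp ?_
    rw [← Metric.cobounded_eq_cocompact, ← tendsto_norm_atTop_iff_cobounded]
    have h2 : Tendsto (fun n : ℕ => (2 : ℝ) ^ n * ‖z‖ - ‖x‖) atTop atTop :=
      tendsto_atTop_add_const_right _ _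
        ((tendsto_pow_atTop_atTop_of_one_lt (by norm_num)).atTop_mul_const (norm_pos_iff.2 hz))
    refine tendsto_atTop_mono (fun n => ?_) h2
    have h3 := norm_sub_norm_le ((2 : ℝ) ^ n • z) x
    rw [norm_smul, norm_sub_rev] at h3
    simpa using h3

/-- The partial Littlewood–Paley sums. -/
def part (n : ℕ) (f : 𝓢(V, ℂ)) : 𝓢(V, ℂ) := ∑ k ∈ Finset.Ico (-n : ℤ) n, mult χ.phi k f

theorem tendsto_part [Nontrivial V] (f : 𝓢(V, ℂ)) (x : V) :
    Tendsto (fun n => χ.part n f x) atTop (𝓝 (f x)) := by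
  simp only [part, sum_mult_phi, sub_apply]
  simpa using (χ.tendsto_low_atTop f x).sub (χ.tendsto_low_atBot f x)

theorem exists_norm_part_le (f : 𝓢(V, ℂ)) : ∃ B : ℝ, 0 ≤ B ∧ ∀ n x, ‖χ.part n f x‖ ≤ B := by
  set A := (∫ z, ‖ker χ.low z‖) * SchwartzMap.seminorm ℝ 0 0 f
  have hA : 0 ≤ A := by positivity
  refine ⟨A + A, by positivity, fun n x => ?_⟩
  simp only [part, sum_mult_phi, sub_apply]
  exact (norm_sub_le _ _).trans (add_le_add (norm_mult_le _ _ _ _ (norm_le_seminorm ℝ f))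
    (norm_mult_le _ _ _ _ (norm_le_seminorm ℝ f)))

theorem tendsto_mult_sprod_part [Nontrivial V] (m : 𝓢(V, ℂ)) (q : ℤ) (f g : 𝓢(V, ℂ)) (x : V) :
    Tendsto (fun n => mult m q (sprod (χ.part n f) (χ.part n g)) x) atTop
      (𝓝 (mult m q (sprod f g) x)) := by
  obtain ⟨A, hA, hA'⟩ := χ.exists_norm_part_le f
  obtain ⟨B, hB, hB'⟩ := χ.exists_norm_part_le g
  rw [mult_apply m q (sprod f g)]
  refine tendsto_mult_apply m (fun _ => q) (fun n => sprod (χ.part n f) (χ.part n g)) x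
    (L := fun z => sprod f g (x - (2 : ℝ) ^ (-q) • z)) (B := A * B) ?_ ?_
  · intro n y
    rw [sprod_apply, norm_mul]
    exact mul_le_mul (hA' _ _) (hB' _ _) (norm_nonneg _) hA
  · refine Eventually.of_forall fun z => ?_
    simp only [sprod_apply]
    exact (χ.tendsto_part f _).mul (χ.tendsto_part g _)

theorem eLpNorm_mult_sprod_le [Nontrivial V] (m : 𝓢(V, ℂ)) {p : ℝ} (hp : 1 ≤ p) (q : ℤ)
    (f g : 𝓢(V, ℂ)) :
    eLpNorm (mult m q (sprod f g)) (ENNReal.ofReal p) volume ≤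
      ∑' j : ℤ, ∑' k : ℤ, eLpNorm (mult m q (sprod (mult χ.phi j f) (mult χ.phi k g)))
        (ENNReal.ofReal p) volume := by
  have hp' : 1 ≤ ENNReal.ofReal p := by simpa using hp
  refine (Lp.eLpNorm_lim_le_liminf_eLpNorm (f := fun n => ⇑(mult m q (sprod (χ.part n f) (χ.part n g))))
    (fun n => (SchwartzMap.continuous _).aestronglyMeasurable) _
    (Eventually.of_forall (χ.tendsto_mult_sprod_part m q f g))).trans ?_
  refine liminf_le_of_frequently_le' (Frequently.of_forall fun n => ?_)
  have h1 : mult m q (sprod (χ.part n f) (χ.part n g)) =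
      ∑ j ∈ Finset.Ico (-n : ℤ) n, ∑ k ∈ Finset.Ico (-n : ℤ) n,
        mult m q (sprod (mult χ.phi j f) (mult χ.phi k g)) := by
    simp only [part, sprod, map_sum, sum_apply]
    rw [Finset.sum_comm]
  have h2 : ∀ (t : Finset ℤ) (F : ℤ → 𝓢(V, ℂ)), eLpNorm (⇑(∑ i ∈ t, F i)) (ENNReal.ofReal p) volume ≤
      ∑ i ∈ t, eLpNorm (F i) (ENNReal.ofReal p) volume := by
    intro t F
    have := eLpNorm_sum_le (f := fun i => ⇑(F i)) (s := t) (μ := (volume : Measure V))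
      (fun i _ => (F i).continuous.aestronglyMeasurable) hp'
    refine le_trans (le_of_eq ?_) this
    congr 1
    ext x
    simp
  rw [h1]
  calc _ ≤ ∑ j ∈ Finset.Ico (-n : ℤ) n, ∑ k ∈ Finset.Ico (-n : ℤ) n,
        eLpNorm (mult m q (sprod (mult χ.phi j f) (mult χ.phi k g))) (ENNReal.ofReal p) volume :=
        (h2 _ _).trans (Finset.sum_le_sum fun j _ => h2 _ _)
    _ ≤ ∑ j ∈ Finset.Ico (-n : ℤ) n, ∑' k : ℤ,
        eLpNorm (mult m q (sprod (mult χ.phi j f) (mult χ.phi k g))) (ENNReal.ofReal p) volume :=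
        Finset.sum_le_sum fun j _ => ENNReal.sum_le_tsum _
    _ ≤ _ := ENNReal.sum_le_tsum _

end LPF

end Convergence

section ProductLaw

variable {V : Type*} [NormedAddCommGroup V] [InnerProductSpace ℝ V]
    [FiniteDimensional ℝ V] [MeasurableSpace V] [BorelSpace V]

/-- The dyadic weight `2^{ak}`. -/
def dw (a : ℝ) (k : ℤ) : ℝ≥0∞ := ENNReal.ofReal ((2 : ℝ) ^ (a * (k : ℝ)))

theorem dw_mul_dw (a b : ℝ) (j k : ℤ) :
    dw a j * dw b k = ENNReal.ofReal ((2 : ℝ) ^ (a * j + b * k)) := by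
  rw [dw, dw, ← ENNReal.ofReal_mul (by positivity), ← Real.rpow_add (by norm_num)]

theorem dw_mul_dw_same (a b : ℝ) (k : ℤ) : dw a k * dw b k = dw (a + b) k := by
  rw [dw_mul_dw, dw, add_mul]

theorem dw_mul_dw_le {a b : ℝ} (hab : a ≤ b) {j k : ℤ} (hkj : k ≤ j) :
    dw a j * dw b k ≤ dw b j * dw a k := by
  rw [dw_mul_dw, dw_mul_dw]
  refine ENNReal.ofReal_le_ofReal (Real.rpow_le_rpow_of_exponent_le (by norm_num) ?_)
  have : (k : ℝ) ≤ j := by exact_mod_cast hkj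
  nlinarith

theorem dw_le_mul_dw (a : ℝ) {q k : ℤ} (h1 : k - 4 ≤ q) (h2 : q ≤ k + 4) :
    dw a q ≤ dw (4 * |a|) 1 * dw a k := by
  rw [dw_mul_dw]
  refine ENNReal.ofReal_le_ofReal (Real.rpow_le_rpow_of_exponent_le (by norm_num) ?_)
  have h1 : (k : ℝ) - 4 ≤ q := by exact_mod_cast h1
  have h2 : (q : ℝ) ≤ k + 4 := by exact_mod_cast h2
  have h3 : a * (q - k) ≤ |a| * 4 := by
    refine (le_abs_self _).trans ?_
    rw [abs_mul]
    gcongr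
    rw [abs_le]
    constructor <;> linarith
  push_cast
  linarith

/-- The sum of the geometric series `∑_{m ≥ 0} 2^{-σm}`. -/
def geo (σ : ℝ) : ℝ≥0∞ := ∑' n : ℕ, dw (-σ) n

theorem geo_ne_top {σ : ℝ} (hσ : 0 < σ) : geo σ ≠ ⊤ := by
  have h : ∀ n : ℕ, dw (-σ) n = ENNReal.ofReal ((2 : ℝ) ^ (-σ)) ^ n := by
    intro n
    rw [dw, Real.rpow_mul (by norm_num), Int.cast_natCast, Real.rpow_natCast,
      ENNReal.ofReal_pow (by positivity)]
  have h1 : ENNReal.ofReal ((2 : ℝ) ^ (-σ)) < 1 := by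
    rw [ENNReal.ofReal_lt_one]
    exact Real.rpow_lt_one_of_one_lt_of_neg (by norm_num) (by linarith)
  simp only [geo, h, ENNReal.tsum_geometric]
  exact ENNReal.inv_ne_top.2 (tsub_pos_of_lt h1).ne'

theorem tsum_dw_le {σ : ℝ} {q₀ : ℤ} {f : ℤ → ℝ≥0∞} {A : ℝ≥0∞} (h0 : ∀ q, q₀ < q → f q = 0)
    (h : ∀ q, q ≤ q₀ → f q ≤ A * dw σ q) : ∑' q, f q ≤ A * dw σ q₀ * geo σ := by
  have hinj : Function.Injective fun n : ℕ => q₀ - n := fun a b hab => by simpa using hab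
  rw [← hinj.tsum_eq (f := f) ?_]
  · rw [geo, ← ENNReal.tsum_mul_left]
    refine ENNReal.tsum_le_tsum fun n => (h _ (by simp)).trans (le_of_eq ?_)
    rw [mul_assoc, dw_mul_dw, dw]
    congr 3
    push_cast
    ring
  · intro q hq
    by_contra hq'
    refine hq (h0 q ?_)
    by_contra! h2
    exact hq' ⟨(q₀ - q).toNat, by simp; omega⟩

theorem tsum_le_of_near {a : ℝ} {k : ℤ} {f : ℤ → ℝ≥0∞} {A : ℝ≥0∞}
    (h0 : ∀ q, q < k - 2 ∨ k + 2 < q → f q = 0) (h : ∀ q, f q ≤ dw a q * A) :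
    ∑' q, f q ≤ 5 * dw (4 * |a|) 1 * dw a k * A := by
  rw [tsum_eq_sum (s := Finset.Icc (k - 2) (k + 2))]
  · calc ∑ q ∈ Finset.Icc (k - 2) (k + 2), f q
        ≤ ∑ q ∈ Finset.Icc (k - 2) (k + 2), dw (4 * |a|) 1 * dw a k * A := by
          refine Finset.sum_le_sum fun q hq => (h q).trans ?_
          rw [Finset.mem_Icc] at hq
          gcongr
          exact dw_le_mul_dw a (by omega) (by omega)
      _ = _ := by
          rw [Finset.sum_const, Int.card_Icc, show (k + 2 + 1 - (k - 2)).toNat = 5 by omega]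
          simp [mul_assoc]
  · intro q hq
    rw [Finset.mem_Icc] at hq
    exact h0 q (by omega)

theorem eLpNorm_sprod_le_left {f g : 𝓢(V, ℂ)} {p : ℝ} {A : ℝ≥0∞} (hA : ∀ x, ‖f x‖ₑ ≤ A)
    (hAt : A ≠ ⊤) :
    eLpNorm (sprod f g) (ENNReal.ofReal p) volume ≤ A * eLpNorm g (ENNReal.ofReal p) volume := by
  lift A to ℝ≥0 using hAt
  refine (eLpNorm_le_nnreal_smul_eLpNorm_of_ae_le_mul (c := A) (g := g)
    (Eventually.of_forall fun x => ?_) (ENNReal.ofReal p)).trans (le_of_eq ?_)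
  · rw [sprod_apply, nnnorm_mul]
    gcongr
    exact_mod_cast hA x
  · rw [ENNReal.smul_def, smul_eq_mul]

theorem sprod_comm (f g : 𝓢(V, ℂ)) : sprod f g = sprod g f := by
  ext x
  simp [mul_comm]

theorem eLpNorm_sprod_half_le (f g : 𝓢(V, ℂ)) {p : ℝ} (hp : 2 ≤ p) :
    eLpNorm (sprod f g) (ENNReal.ofReal (p / 2)) volume ≤
      eLpNorm f (ENNReal.ofReal p) volume * eLpNorm g (ENNReal.ofReal p) volume := by
  have : ENNReal.HolderTriple (ENNReal.ofReal p) (ENNReal.ofReal p) (ENNReal.ofReal (p / 2)) := by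
    constructor
    rw [← ENNReal.ofReal_inv_of_pos (by linarith), ← ENNReal.ofReal_inv_of_pos (by linarith),
      ← ENNReal.ofReal_add (by positivity) (by positivity)]
    congr 1
    field_simp
    norm_num
  have h := eLpNorm_smul_le_mul_eLpNorm (μ := (volume : Measure V)) (p := ENNReal.ofReal p)
    (q := ENNReal.ofReal p) (r := ENNReal.ofReal (p / 2)) (φ := ⇑f) (f := ⇑g)
    g.continuous.aestronglyMeasurable f.continuous.aestronglyMeasurable
  refine le_trans (le_of_eq ?_) h
  congr 1

namespace LPF
variable (χ : LPF V)

theorem exists_piece_le {p s : ℝ} (hp : 2 ≤ p) (hs : s ≤ Module.finrank ℝ V / p)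
    (hs' : 0 < s + Module.finrank ℝ V / p) : ∃ C : ℝ≥0, ∀ (j k : ℤ) (f g : 𝓢(V, ℂ)),
    ∑' q : ℤ, dw s q * eLpNorm (mult χ.phi q (sprod (mult χ.phi j f) (mult χ.phi k g)))
        (ENNReal.ofReal p) volume ≤
      C * ((dw (Module.finrank ℝ V / p) j * eLpNorm (mult χ.phi j f) (ENNReal.ofReal p) volume) *
        (dw s k * eLpNorm (mult χ.phi k g) (ENNReal.ofReal p) volume)) := by
  set δ : ℝ := Module.finrank ℝ V / p with hδ
  obtain ⟨B, hB⟩ := χ.exists_enorm_block_le (p := p) (by linarith)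
  obtain ⟨H, hH⟩ := exists_eLpNorm_mult_le_half χ.phi hp
  obtain ⟨K, hK⟩ := exists_coe_eq ((ker χ.phi).memLp 1 volume).2.ne
  have hK := fun k h => hK ▸ eLpNorm_mult_le χ.phi (r := p) (by linarith) k h
  have hdw : ∀ k : ℤ, ENNReal.ofReal ((2 : ℝ) ^ ((k : ℝ) * δ)) = dw δ k := fun k => by
    rw [dw, mul_comm]
  simp only [← hδ, hdw] at hB hH
  obtain ⟨W, hW⟩ := exists_coe_eq (a := dw (4 * |s|) 1) ENNReal.ofReal_ne_top
  obtain ⟨W', hW'⟩ := exists_coe_eq (a := dw (4 * |s + δ|) 1) ENNReal.ofReal_ne_top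
  obtain ⟨G, hG⟩ := exists_coe_eq (geo_ne_top hs')
  refine ⟨5 * W * K * B + 5 * W * K * B + H * W' * G * W, fun j k f g => ?_⟩
  set a := eLpNorm (mult χ.phi j f) (ENNReal.ofReal p) volume with ha
  set b := eLpNorm (mult χ.phi k g) (ENNReal.ofReal p) volume with hb
  have ha' : a ≠ ⊤ := ((mult χ.phi j f).memLp _ volume).2.ne
  have hb' : b ≠ ⊤ := ((mult χ.phi k g).memLp _ volume).2.ne
  set R := (dw δ j * a) * (dw s k * b) with hR
  have hab1 : eLpNorm (sprod (mult χ.phi j f) (mult χ.phi k g)) (ENNReal.ofReal p) volume ≤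
      B * dw δ j * a * b := eLpNorm_sprod_le_left (hB j f)
        (ENNReal.mul_ne_top (ENNReal.mul_ne_top ENNReal.coe_ne_top ENNReal.ofReal_ne_top) ha')
  have hab2 : eLpNorm (sprod (mult χ.phi j f) (mult χ.phi k g)) (ENNReal.ofReal p) volume ≤
      B * dw δ k * b * a := by
    rw [sprod_comm]
    exact eLpNorm_sprod_le_left (hB k g)
        (ENNReal.mul_ne_top (ENNReal.mul_ne_top ENNReal.coe_ne_top ENNReal.ofReal_ne_top) hb')
  have hzero : ∀ q, (max j k + 3 ≤ q ∨ (j + 3 ≤ k ∧ q + 3 ≤ k) ∨ (k + 3 ≤ j ∧ q + 3 ≤ j)) →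
      dw s q * eLpNorm (mult χ.phi q (sprod (mult χ.phi j f) (mult χ.phi k g)))
        (ENNReal.ofReal p) volume = 0 := by
    intro q hq
    rw [χ.block_block_mul_eq_zero f g hq]
    simp
  rcases le_or_gt (j + 3) k with hjk | hjk
  · calc _ ≤ 5 * dw (4 * |s|) 1 * dw s k * (K * (B * dw δ j * a * b)) := by
          refine tsum_le_of_near (fun q hq => hzero q ?_) fun q => ?_
          · omega
          · gcongr
            exact (hK _ _).trans (by gcongr)
      _ = (5 * W * K * B) * R := by rw [← hW, hR]; ring
      _ ≤ _ := by
          gcongr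
          push_cast
          rw [add_assoc]
          exact le_self_add
  rcases le_or_gt (k + 3) j with hkj | hkj
  · calc _ ≤ 5 * dw (4 * |s|) 1 * dw s j * (K * (B * dw δ k * b * a)) := by
          refine tsum_le_of_near (fun q hq => hzero q ?_) fun q => ?_
          · omega
          · gcongr
            exact (hK _ _).trans (by gcongr)
      _ = (5 * W * K * B) * (dw s j * dw δ k) * (a * b) := by rw [← hW]; ring
      _ ≤ (5 * W * K * B) * (dw δ j * dw s k) * (a * b) := by
          exact mul_le_mul' (mul_le_mul' le_rfl (dw_mul_dw_le hs (by omega))) le_rfl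
      _ = (5 * W * K * B) * R := by rw [hR]; ring
      _ ≤ _ := by
          gcongr
          push_cast
          rw [add_assoc]
          exact le_self_add
  · calc _ ≤ (H * (a * b)) * dw (s + δ) (j + 4) * geo (s + δ) := by
          refine tsum_dw_le (fun q hq => hzero q ?_) fun q hq => ?_
          · omega
          · rw [← dw_mul_dw_same]
            calc _ ≤ dw s q * (H * dw δ q * (a * b)) := by
                  gcongr
                  exact (hH _ _).trans (by gcongr; exact eLpNorm_sprod_half_le _ _ hp)
              _ = _ := by ring
      _ ≤ (H * (a * b)) * (W' * (W * dw s k * dw δ j)) * G := by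
          rw [hG]
          gcongr
          refine (dw_le_mul_dw _ (k := j) (by omega) (by omega)).trans ?_
          rw [hW', ← dw_mul_dw_same]
          gcongr
          rw [hW]
          exact dw_le_mul_dw _ (by omega) (by omega)
      _ = (H * W' * G * W) * R := by rw [hR]; ring
      _ ≤ _ := by
          gcongr
          push_cast
          exact le_add_self

/-- **Product law** `Ḃ^{d/p}_{p,1} · Ḃ^s_{p,1} ⊂ Ḃ^s_{p,1}`. -/
theorem exists_besov_sprod_le [Nontrivial V] {p s : ℝ} (hp : 2 ≤ p)
    (hs : s ≤ Module.finrank ℝ V / p) (hs' : 0 < s + Module.finrank ℝ V / p) :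
    ∃ C : ℝ≥0, ∀ f g : 𝓢(V, ℂ), besov χ s p (sprod f g) ≤
      C * (besov χ (Module.finrank ℝ V / p) p f * besov χ s p g) := by
  obtain ⟨C, hC⟩ := χ.exists_piece_le hp hs hs'
  refine ⟨C, fun f g => ?_⟩
  simp only [besov_eq]
  calc _ ≤ ∑' q : ℤ, ∑' j : ℤ, ∑' k : ℤ, dw s q *
        eLpNorm (mult χ.phi q (sprod (mult χ.phi j f) (mult χ.phi k g)))
          (ENNReal.ofReal p) volume := by
        refine ENNReal.tsum_le_tsum fun q => ?_
        simp only [ENNReal.tsum_mul_left]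
        gcongr
        · exact le_rfl
        · exact χ.eLpNorm_mult_sprod_le χ.phi (by linarith) q f g
    _ = ∑' j : ℤ, ∑' k : ℤ, ∑' q : ℤ, dw s q *
        eLpNorm (mult χ.phi q (sprod (mult χ.phi j f) (mult χ.phi k g)))
          (ENNReal.ofReal p) volume := by
        rw [ENNReal.tsum_comm]
        exact tsum_congr fun j => ENNReal.tsum_comm
    _ ≤ _ := ENNReal.tsum_le_tsum fun j => ENNReal.tsum_le_tsum fun k => hC j k f g
    _ = _ := by
        simp only [ENNReal.tsum_mul_left, ENNReal.tsum_mul_right]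
        rfl

end LPF

end ProductLaw

section Derivatives

namespace LPF
variable {n : ℕ} (χ : LPF (Euc n))

/-- The function `ξ ↦ ξ_i / (2πi |ξ|²)` cut off to an annulus. -/
def rieszFun (i : Fin n) (ξ : Euc n) : ℂ :=
  χ.wide ξ * ((ξ i / ‖ξ‖ ^ 2 : ℝ) * (2 * Real.pi * Complex.I)⁻¹)

theorem hasCompactSupport_rieszFun (i : Fin n) : HasCompactSupport (χ.rieszFun i) := by
  refine HasCompactSupport.mul_right (f := ⇑χ.wide) ?_
  exact (χ.hasCompactSupport_comp_smul (c := 4⁻¹) (by norm_num)).sub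
    (χ.hasCompactSupport_comp_smul (c := 2) (by norm_num))

theorem contDiff_rieszFun (i : Fin n) : ContDiff ℝ ∞ (χ.rieszFun i) := by
  rw [contDiff_iff_contDiffAt]
  intro ξ
  by_cases h : ξ = 0
  · subst h
    refine (contDiffAt_const (c := (0 : ℂ))).congr_of_eventuallyEq ?_
    filter_upwards [Metric.ball_mem_nhds (0 : Euc n) (show (0 : ℝ) < 1 / 2 by norm_num)] with η hη
    rw [rieszFun, χ.wide_eq_zero (by simpa using (Metric.mem_ball.1 hη).le), zero_mul]
  · unfold rieszFun
    refine (χ.wide.smooth _).contDiffAt.mul (ContDiffAt.mul ?_ contDiffAt_const)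
    refine Complex.ofRealCLM.contDiff.contDiffAt.comp ξ ?_
    refine ContDiffAt.div ?_ (contDiff_norm_sq ℝ).contDiffAt (by simpa using h)
    exact (EuclideanSpace.proj (𝕜 := ℝ) i).contDiff.contDiffAt

/-- The Schwartz symbol recovering a function from its `i`-th derivative. -/
def riesz (i : Fin n) : 𝓢(Euc n, ℂ) :=
  (χ.hasCompactSupport_rieszFun i).toSchwartzMap (χ.contDiff_rieszFun i)

theorem riesz_apply (i : Fin n) (ξ : Euc n) : χ.riesz i ξ =
  χ.wide ξ * ((ξ i / ‖ξ‖ ^ 2 : ℝ) * (2 * Real.pi * Complex.I)⁻¹) := rfl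

/-- The `i`-th partial derivative of a Schwartz function. -/
def sder (i : Fin n) (h : 𝓢(Euc n, ℂ)) : 𝓢(Euc n, ℂ) := ∂_{EuclideanSpace.single i (1 : ℝ)} h

theorem sder_apply (i : Fin n) (h : 𝓢(Euc n, ℂ)) (x : Euc n) : sder i h x = pdv i h x := rfl

theorem fourier_sder (i : Fin n) (h : 𝓢(Euc n, ℂ)) (ξ : Euc n) :
    𝓕 (sder i h) ξ = 2 * Real.pi * Complex.I * (ξ i * 𝓕 h ξ) := by
  have : (inner ℝ · (EuclideanSpace.single i (1 : ℝ)) : Euc n → ℝ).HasTemperateGrowth := by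
    fun_prop
  rw [sder, fourier_lineDerivOp_eq, smul_apply, smulLeftCLM_apply_apply this]
  simp [EuclideanSpace.inner_single_right]

theorem block_eq_sum_riesz (k : ℤ) (h : 𝓢(Euc n, ℂ)) : mult χ.phi k h =
    ∑ i, ((2 : ℂ) ^ (-k)) • mult (χ.riesz i) k (mult χ.phi k (sder i h)) := by
  have : 𝓕 (mult χ.phi k h) =
      𝓕 (∑ i, ((2 : ℂ) ^ (-k)) • mult (χ.riesz i) k (mult χ.phi k (sder i h))) := by
    rw [show 𝓕 (∑ i, ((2 : ℂ) ^ (-k)) • mult (χ.riesz i) k (mult χ.phi k (sder i h))) =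
      ∑ i, ((2 : ℂ) ^ (-k)) • 𝓕 (mult (χ.riesz i) k (mult χ.phi k (sder i h))) by
      change FourierTransform.fourierCLM ℂ 𝓢(Euc n, ℂ) _ = _
      simp only [map_sum, map_smul]
      rfl]
    ext ξ
    simp only [sum_apply, smul_apply, fourier_mult, fourier_sder, smul_eq_mul, dilSymb,
      riesz_apply]
    set η := (2 : ℝ) ^ (-k) • ξ with hη
    have hηi : ∀ i, (η i : ℂ) = (2 : ℂ) ^ (-k) * ξ i := by
      intro i
      simp [hη]
    by_cases h0 : η = 0
    · simp [χ.phi_eq_zero (ξ := η) (by simp [h0])]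
    have h1 : ∀ i, (2 : ℂ) ^ (-k) * (χ.wide η * ((η i / ‖η‖ ^ 2 : ℝ) *
        (2 * Real.pi * Complex.I)⁻¹) * (χ.phi η * (2 * Real.pi * Complex.I *
          (ξ i * 𝓕 h ξ)))) = ((η i ^ 2 / ‖η‖ ^ 2 : ℝ) : ℂ) * (χ.phi η * 𝓕 h ξ) := by
      intro i
      have h2 : (2 * Real.pi * Complex.I : ℂ) ≠ 0 := Complex.two_pi_I_ne_zero
      calc _ = (χ.wide η * χ.phi η) * ((2 * Real.pi * Complex.I)⁻¹ * (2 * Real.pi * Complex.I))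
            * (η i / ‖η‖ ^ 2 : ℝ) * ((2 : ℂ) ^ (-k) * ξ i) * 𝓕 h ξ := by ring
        _ = _ := by
          rw [χ.wide_mul_phi, inv_mul_cancel₀ h2, ← hηi]
          push_cast
          ring
    simp only [h1]
    rw [← Finset.sum_mul, ← Complex.ofReal_sum, ← Finset.sum_div]
    have h3 : ∑ i, η i ^ 2 = ‖η‖ ^ 2 := by
      rw [EuclideanSpace.norm_sq_eq]
      simp
    rw [h3, div_self (by simpa using h0)]
    simp
  simpa using congrArg (fun g : 𝓢(Euc n, ℂ) => 𝓕⁻ g) this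

theorem exists_besov_le_sder {p : ℝ} (hp : 1 ≤ p) (a : ℝ) : ∃ C : ℝ≥0, ∀ h : 𝓢(Euc n, ℂ),
    besov χ a p h ≤ C * ∑ i, besov χ (a - 1) p (sder i h) := by
  have hp' : 1 ≤ ENNReal.ofReal p := by simpa using hp
  choose K hK using fun i => exists_coe_eq ((ker (χ.riesz i)).memLp 1 volume).2.ne
  refine ⟨∑ i, K i, fun h => ?_⟩
  simp only [besov_eq]
  rw [Finset.mul_sum]
  calc _ ≤ ∑' k : ℤ, ∑ i, (∑ i, K i : ℝ≥0) * (ENNReal.ofReal ((2 : ℝ) ^ ((a - 1) * (k : ℝ))) *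
        eLpNorm (mult χ.phi k (sder i h)) (ENNReal.ofReal p) volume) := by
        refine ENNReal.tsum_le_tsum fun k => ?_
        rw [χ.block_eq_sum_riesz]
        have h1 := eLpNorm_sum_le (s := Finset.univ) (μ := (volume : Measure (Euc n)))
          (f := fun i => ⇑((2 : ℂ) ^ (-k) • mult (χ.riesz i) k (mult χ.phi k (sder i h))))
          (fun i _ => (SchwartzMap.continuous _).aestronglyMeasurable) hp'
        have h2 : ⇑(∑ i, ((2 : ℂ) ^ (-k)) • mult (χ.riesz i) k (mult χ.phi k (sder i h))) =
            ∑ i, ⇑((2 : ℂ) ^ (-k) • mult (χ.riesz i) k (mult χ.phi k (sder i h))) := by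
          ext x
          simp
        rw [h2]
        refine (mul_le_mul_right h1 _).trans ?_
        rw [Finset.mul_sum]
        refine Finset.sum_le_sum fun i _ => ?_
        have h3 : eLpNorm ⇑((2 : ℂ) ^ (-k) • mult (χ.riesz i) k (mult χ.phi k (sder i h)))
            (ENNReal.ofReal p) volume = ENNReal.ofReal ((2 : ℝ) ^ (-(k : ℝ))) *
            eLpNorm (mult (χ.riesz i) k (mult χ.phi k (sder i h))) (ENNReal.ofReal p) volume := by
          have h4 : ⇑((2 : ℂ) ^ (-k) • mult (χ.riesz i) k (mult χ.phi k (sder i h))) =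
            (2 : ℂ) ^ (-k) • ⇑(mult (χ.riesz i) k (mult χ.phi k (sder i h))) := rfl
          rw [h4, eLpNorm_const_smul, ← ofReal_norm]
          congr 2
          rw [← Int.cast_neg, Real.rpow_intCast]
          simp
        rw [h3, ← mul_assoc, ← ENNReal.ofReal_mul (by positivity), ← Real.rpow_add (by norm_num),
          show a * (k : ℝ) + -k = (a - 1) * k by ring, mul_left_comm]
        gcongr
        refine (eLpNorm_mult_le _ hp _ _).trans ?_
        rw [← hK i]
        gcongr
        exact_mod_cast Finset.single_le_sum (f := K) (fun _ _ => zero_le) (Finset.mem_univ i)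
    _ = _ := by
        rw [Summable.tsum_finsetSum fun _ _ => ENNReal.summable]
        simp only [ENNReal.tsum_mul_left]

end LPF

end Derivatives

section Slices

variable {n : ℕ}

/-- Smooth space-time functions vanishing for `t ≤ 0`, with spatial support in a fixed compact
set. -/
structure Tame (F : ℝ → Euc n → ℂ) : Prop where
  smooth : ContDiff ℝ ∞ (Function.uncurry F)
  eq_zero : ∀ t ≤ 0, ∀ y, F t y = 0
  supp : ∃ K : Set (Euc n), IsCompact K ∧ ∀ t, ∀ y ∉ K, F t y = 0

/-- The time derivative. -/
def tder (F : ℝ → Euc n → ℂ) (t : ℝ) (y : Euc n) : ℂ := deriv (fun τ => F τ y) t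

namespace Tame
variable {F G : ℝ → Euc n → ℂ}

theorem hasDerivAt' (hF : Tame F) (t : ℝ) (y : Euc n) :
    HasDerivAt (fun τ => F τ y) (fderiv ℝ (Function.uncurry F) (t, y) (1, 0)) t := by
  have h1 : HasFDerivAt (Function.uncurry F) (fderiv ℝ (Function.uncurry F) (t, y)) (t, y) :=
    (hF.smooth.differentiable (by simp)).differentiableAt.hasFDerivAt
  exact h1.comp_hasDerivAt t ((hasDerivAt_id t).prodMk (hasDerivAt_const t y))

theorem tder_eq (hF : Tame F) (t : ℝ) (y : Euc n) :
    tder F t y = fderiv ℝ (Function.uncurry F) (t, y) (1, 0) := (hF.hasDerivAt' t y).deriv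

theorem hasDerivAt (hF : Tame F) (t : ℝ) (y : Euc n) :
    HasDerivAt (fun τ => F τ y) (tder F t y) t := hF.tder_eq t y ▸ hF.hasDerivAt' t y

theorem tder (hF : Tame F) : Tame (tder F) := by
  have hs : ContDiff ℝ ∞ (Function.uncurry (MHD.tder F)) := by
    have : Function.uncurry (MHD.tder F) =
        fun q => fderiv ℝ (Function.uncurry F) q ((1 : ℝ), (0 : Euc n)) :=
      funext fun q => hF.tder_eq q.1 q.2
    rw [this]
    exact (hF.smooth.fderiv_right (m := ∞) (by simp)).clm_apply contDiff_const
  have h0 : ∀ t < 0, ∀ y, MHD.tder F t y = 0 := by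
    intro t ht y
    have : (fun τ => F τ y) =ᶠ[𝓝 t] fun _ => 0 := by
      filter_upwards [Iio_mem_nhds ht] with τ hτ using hF.eq_zero τ (le_of_lt hτ) y
    rw [MHD.tder, this.deriv_eq, deriv_const]
  refine ⟨hs, fun t ht y => ?_, ?_⟩
  · have hc : Continuous fun τ => MHD.tder F τ y :=
      hs.continuous.comp (Continuous.prodMk_left y)
    have hcl : IsClosed {τ | MHD.tder F τ y = 0} := isClosed_eq hc continuous_const
    have : Set.Iic (0 : ℝ) ⊆ {τ | MHD.tder F τ y = 0} := by
      rw [← closure_Iio]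
      exact hcl.closure_subset_iff.2 fun τ hτ => h0 τ hτ y
    exact this ht
  · obtain ⟨K, hK, hK'⟩ := hF.supp
    refine ⟨K, hK, fun t y hy => ?_⟩
    simp [MHD.tder, hK' _ y hy]

theorem mul (hF : Tame F) (hG : Tame G) : Tame fun t y => F t y * G t y := by
  obtain ⟨K, hK, hK'⟩ := hF.supp
  exact ⟨hF.smooth.mul hG.smooth, fun t ht y => by simp [hF.eq_zero t ht y],
    K, hK, fun t y hy => by simp [hK' t y hy]⟩

theorem add (hF : Tame F) (hG : Tame G) : Tame fun t y => F t y + G t y := by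
  obtain ⟨K, hK, hK'⟩ := hF.supp
  obtain ⟨L, hL, hL'⟩ := hG.supp
  refine ⟨hF.smooth.add hG.smooth, fun t ht y => by simp [hF.eq_zero t ht y, hG.eq_zero t ht y],
    K ∪ L, hK.union hL, fun t y hy => ?_⟩
  rw [Set.mem_union, not_or] at hy
  simp [hK' t y hy.1, hL' t y hy.2]

theorem const_mul (hF : Tame F) (c : ℂ) : Tame fun t y => c * F t y := by
  obtain ⟨K, hK, hK'⟩ := hF.supp
  exact ⟨contDiff_const.mul hF.smooth, fun t ht y => by simp [hF.eq_zero t ht y],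
    K, hK, fun t y hy => by simp [hK' t y hy]⟩

theorem zero : Tame fun (_ : ℝ) (_ : Euc n) => (0 : ℂ) :=
  ⟨contDiff_const, fun _ _ _ => rfl, ∅, isCompact_empty, fun _ _ _ => rfl⟩

theorem sum {ι : Type*} {s : Finset ι} {F : ι → ℝ → Euc n → ℂ} (hF : ∀ i ∈ s, Tame (F i)) :
    Tame fun t y => ∑ i ∈ s, F i t y := by
  classical
  induction s using Finset.induction_on with
  | empty => simpa using zero
  | insert a s ha ih =>
    simp only [Finset.sum_insert ha]
    exact (hF a (by simp)).add (ih fun i hi => hF i (by simp [hi]))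

/-- A time slice as a Schwartz function. -/
def slice (hF : Tame F) (t : ℝ) : 𝓢(Euc n, ℂ) :=
  (show HasCompactSupport (F t) from
    let ⟨_, hK, hK'⟩ := hF.supp
    HasCompactSupport.intro hK fun y hy => hK' t y hy).toSchwartzMap
  (hF.smooth.comp (contDiff_prodMk_right t))

@[simp] theorem coe_slice (hF : Tame F) (t : ℝ) : ⇑(hF.slice t) = F t := rfl

theorem slice_apply (hF : Tame F) (t : ℝ) (y : Euc n) : hF.slice t y = F t y := rfl

theorem bounded (hF : Tame F) (T : ℝ) : ∃ B : ℝ, ∀ t ≤ T, ∀ y, ‖F t y‖ ≤ B := by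
  obtain ⟨K, hK, hK'⟩ := hF.supp
  obtain ⟨B, hB⟩ := ((isCompact_Icc (a := (0 : ℝ)) (b := T)).prod hK).exists_bound_of_continuousOn
    hF.smooth.continuous.continuousOn
  refine ⟨max B 0, fun t ht y => ?_⟩
  by_cases hy : y ∈ K
  · rcases le_or_gt t 0 with h0 | h0
    · simp [hF.eq_zero t h0 y]
    · exact (hB (t, y) ⟨⟨h0.le, ht⟩, hy⟩).trans (le_max_left _ _)
  · simp [hK' t y hy]

theorem measurable_mult (hF : Tame F) (m : 𝓢(Euc n, ℂ)) (k : ℤ) :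
    Measurable (Function.uncurry fun t x => mult m k (hF.slice t) x) := by
  have h1 : (Function.uncurry fun t x => mult m k (hF.slice t) x) = fun q : ℝ × Euc n =>
      ∫ z, ker m z * F q.1 (q.2 - (2 : ℝ) ^ (-k) • z) := by
    ext q
    exact mult_apply _ _ _ _
  rw [h1]
  refine StronglyMeasurable.measurable ?_
  refine StronglyMeasurable.integral_prod_right
    (f := fun (q : ℝ × Euc n) z => ker m z * F q.1 (q.2 - (2 : ℝ) ^ (-k) • z)) ?_
  refine Continuous.stronglyMeasurable ?_
  have h2 := (ker m).continuous
  have h3 := hF.smooth.continuous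
  have h4 : Continuous fun q : (ℝ × Euc n) × Euc n =>
      Function.uncurry F (q.1.1, q.1.2 - (2 : ℝ) ^ (-k) • q.2) := h3.comp (by fun_prop)
  exact (h2.comp continuous_snd).mul h4

theorem measurable_eLpNorm (hF : Tame F) (m : 𝓢(Euc n, ℂ)) (k : ℤ) {p : ℝ} (hp : 1 ≤ p) :
    Measurable fun t => eLpNorm (mult m k (hF.slice t)) (ENNReal.ofReal p) volume := by
  have hp0 : ENNReal.ofReal p ≠ 0 := by simpa using (by linarith : 0 < p)
  simp only [eLpNorm_eq_lintegral_rpow_enorm_toReal hp0 ENNReal.ofReal_ne_top]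
  refine Measurable.pow_const (Measurable.lintegral_prod_right'
    (f := fun q : ℝ × Euc n => ‖mult m k (hF.slice q.1) q.2‖ₑ ^ (ENNReal.ofReal p).toReal) ?_) _
  exact (hF.measurable_mult m k).enorm.pow_const _

theorem measurable_besov (χ : LPF (Euc n)) (hF : Tame F) (s : ℝ) {p : ℝ} (hp : 1 ≤ p) :
    Measurable fun t => besov χ s p (F t) := by
  simp only [← hF.coe_slice, χ.besov_eq]
  exact Measurable.tsum fun k => (hF.measurable_eLpNorm χ.phi k hp).const_mul _

theorem eq_integral_tder (hF : Tame F) {t : ℝ} (ht : 0 ≤ t) (y : Euc n) :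
    F t y = ∫ τ in Set.Ioc 0 t, MHD.tder F τ y := by
  rw [← intervalIntegral.integral_of_le ht,
    intervalIntegral.integral_eq_sub_of_hasDerivAt (fun τ _ => hF.hasDerivAt τ y)]
  · simp [hF.eq_zero 0 le_rfl y]
  · exact (hF.tder.smooth.continuous.comp (Continuous.prodMk_left y)).intervalIntegrable _ _

theorem mult_slice_eq_integral (hF : Tame F) (m : 𝓢(Euc n, ℂ)) (k : ℤ) {t : ℝ} (ht : 0 ≤ t)
    (x : Euc n) :
    mult m k (hF.slice t) x = ∫ τ in Set.Ioc 0 t, mult m k (hF.tder.slice τ) x := by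
  obtain ⟨B, hB⟩ := hF.tder.bounded t
  simp only [mult_apply, slice_apply, hF.eq_integral_tder ht, ← integral_const_mul]
  refine integral_integral_swap ?_
  have h1 : Integrable (fun q : Euc n × ℝ => ‖ker m q.1‖ * B)
      (volume.prod (volume.restrict (Set.Ioc 0 t))) :=
    (ker m).integrable.norm.mul_prod (integrable_const B)
  refine h1.mono' ?_ ?_
  · refine Continuous.aestronglyMeasurable ?_
    have h2 := (ker m).continuous
    have h3 := hF.tder.smooth.continuous
    have h4 : Continuous fun q : Euc n × ℝ =>
      Function.uncurry (MHD.tder F) (q.2, x - (2 : ℝ) ^ (-k) • q.1) := h3.comp (by fun_prop)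
    exact (h2.comp continuous_fst).mul h4
  · have h5 : ∀ᵐ q ∂((volume : Measure (Euc n)).prod (volume.restrict (Set.Ioc 0 t))),
        q.2 ∈ Set.Ioc 0 t :=
      Measure.quasiMeasurePreserving_snd.ae (ae_restrict_mem measurableSet_Ioc)
    filter_upwards [h5] with q hq
    simp only [Function.uncurry_def, norm_mul]
    gcongr
    exact hB _ hq.2 _

theorem besov_le (χ : LPF (Euc n)) (hF : Tame F) (s : ℝ) {p : ℝ} (hp : 1 ≤ p) (t : ℝ) :
    besov χ s p (F t) ≤ besovT χ s p (Set.Ioi 0) (MHD.tder F) := by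
  rcases le_or_gt t 0 with ht | ht
  · have h0 : hF.slice t = 0 := by
      ext y
      exact hF.eq_zero t ht y
    rw [← hF.coe_slice, χ.besov_eq, h0]
    simp [eLpNorm_zero]
  rw [besovT]
  simp only [← hF.coe_slice, ← hF.tder.coe_slice, χ.besov_eq]
  rw [lintegral_tsum fun k =>
    ((hF.tder.measurable_eLpNorm χ.phi k hp).const_mul _).aemeasurable]
  refine ENNReal.tsum_le_tsum fun k => ?_
  rw [lintegral_const_mul _ (hF.tder.measurable_eLpNorm χ.phi k hp)]
  gcongr
  have h1 : ⇑(mult χ.phi k (hF.slice t)) =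
      fun x => ∫ τ in Set.Ioc 0 t, mult χ.phi k (hF.tder.slice τ) x :=
    funext (hF.mult_slice_eq_integral χ.phi k ht.le)
  rw [h1]
  exact (eLpNorm_integral_le (hF.tder.measurable_mult χ.phi k) hp).trans
    (lintegral_mono_set Set.Ioc_subset_Ioi_self)

end Tame

end Slices

section TimeDerivative

namespace LPF
variable {V : Type*} [NormedAddCommGroup V] [InnerProductSpace ℝ V]
    [FiniteDimensional ℝ V] [MeasurableSpace V] [BorelSpace V] (χ : LPF V)

theorem besov_add_le (s : ℝ) {p : ℝ} (hp : 1 ≤ p) (f g : 𝓢(V, ℂ)) :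
    besov χ s p (f + g : 𝓢(V, ℂ)) ≤ besov χ s p f + besov χ s p g := by
  have hp' : 1 ≤ ENNReal.ofReal p := by simpa using hp
  simp only [besov_eq]
  rw [← ENNReal.tsum_add]
  refine ENNReal.tsum_le_tsum fun k => ?_
  rw [← mul_add, map_add]
  gcongr
  exact eLpNorm_add_le (SchwartzMap.continuous _).aestronglyMeasurable
    (SchwartzMap.continuous _).aestronglyMeasurable hp'

theorem besov_smul (s p : ℝ) (c : ℂ) (f : 𝓢(V, ℂ)) :
    besov χ s p (c • f : 𝓢(V, ℂ)) = ‖c‖ₑ * besov χ s p f := by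
  simp only [besov_eq]
  rw [← ENNReal.tsum_mul_left]
  refine tsum_congr fun k => ?_
  rw [map_smul, mul_left_comm]
  congr 1
  exact eLpNorm_const_smul c _ _ _

end LPF

variable {n : ℕ} (χ : LPF (Euc n))

namespace Tame
variable {F G : ℝ → Euc n → ℂ}

theorem tder_add (hF : Tame F) (hG : Tame G) (t : ℝ) (y : Euc n) :
    MHD.tder (fun t y => F t y + G t y) t y = MHD.tder F t y + MHD.tder G t y :=
  ((hF.hasDerivAt t y).add (hG.hasDerivAt t y)).deriv

theorem tder_mul (hF : Tame F) (hG : Tame G) (t : ℝ) (y : Euc n) :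
    MHD.tder (fun t y => F t y * G t y) t y = MHD.tder F t y * G t y + F t y * MHD.tder G t y :=
  ((hF.hasDerivAt t y).mul (hG.hasDerivAt t y)).deriv

theorem tder_const_mul (hF : Tame F) (c : ℂ) (t : ℝ) (y : Euc n) :
    MHD.tder (fun t y => c * F t y) t y = c * MHD.tder F t y :=
  ((hF.hasDerivAt t y).const_mul c).deriv

theorem besovT_tder_add_le (hF : Tame F) (hG : Tame G) (s : ℝ) {p : ℝ} (hp : 1 ≤ p) :
    besovT χ s p (Set.Ioi 0) (MHD.tder fun t y => F t y + G t y) ≤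
      besovT χ s p (Set.Ioi 0) (MHD.tder F) + besovT χ s p (Set.Ioi 0) (MHD.tder G) := by
  simp only [besovT]
  rw [← lintegral_add_left (hF.tder.measurable_besov χ s hp)]
  refine lintegral_mono fun t => ?_
  have h : MHD.tder (fun t y => F t y + G t y) t =
      (hF.tder.slice t + hG.tder.slice t : 𝓢(Euc n, ℂ)) := by
    ext y
    rw [hF.tder_add hG, add_apply, slice_apply, slice_apply]
  simp only [h]
  exact χ.besov_add_le s hp _ _

theorem besovT_tder_const_mul (hF : Tame F) (c : ℂ) (s : ℝ) {p : ℝ} (hp : 1 ≤ p) :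
    besovT χ s p (Set.Ioi 0) (MHD.tder fun t y => c * F t y) =
      ‖c‖ₑ * besovT χ s p (Set.Ioi 0) (MHD.tder F) := by
  simp only [besovT]
  rw [← lintegral_const_mul _ (hF.tder.measurable_besov χ s hp)]
  refine lintegral_congr fun t => ?_
  have h : MHD.tder (fun t y => c * F t y) t = (c • hF.tder.slice t : 𝓢(Euc n, ℂ)) := by
    ext y
    rw [hF.tder_const_mul, smul_apply, slice_apply, smul_eq_mul]
  rw [h, χ.besov_smul]
  rfl

theorem besovT_tder_zero (s p : ℝ) :
    besovT χ s p (Set.Ioi 0) (MHD.tder fun (_ : ℝ) (_ : Euc n) => (0 : ℂ)) = 0 := by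
  have h : (MHD.tder fun (_ : ℝ) (_ : Euc n) => (0 : ℂ)) = fun _ => ⇑(0 : 𝓢(Euc n, ℂ)) := by
    ext t y
    simp [MHD.tder]
  have h0 : besov χ s p (⇑(0 : 𝓢(Euc n, ℂ))) = 0 := by
    rw [χ.besov_eq]
    simp [eLpNorm_zero]
  rw [h]
  simp only [besovT, h0, lintegral_zero]

theorem besovT_tder_sum_le {ι : Type*} {S : Finset ι} {F : ι → ℝ → Euc n → ℂ}
    (hF : ∀ i ∈ S, Tame (F i)) (s : ℝ) {p : ℝ} (hp : 1 ≤ p) :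
    besovT χ s p (Set.Ioi 0) (MHD.tder fun t y => ∑ i ∈ S, F i t y) ≤
      ∑ i ∈ S, besovT χ s p (Set.Ioi 0) (MHD.tder (F i)) := by
  classical
  induction S using Finset.induction_on with
  | empty => simp [besovT_tder_zero]
  | insert a S ha ih =>
    simp only [Finset.sum_insert ha]
    refine ((hF a (by simp)).besovT_tder_add_le χ
      (Tame.sum fun i hi => hF i (by simp [hi])) s hp).trans ?_
    gcongr
    exact ih fun i hi => hF i (by simp [hi])

end Tame

theorem LPF.exists_besovT_tder_mul_le [Nontrivial (Euc n)] {p s : ℝ} (hp : 2 ≤ p)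
    (hs : s ≤ n / p) (hs' : 0 < s + n / p) :
    ∃ C : ℝ≥0, ∀ F G : ℝ → Euc n → ℂ, Tame F → Tame G →
      besovT χ s p (Set.Ioi 0) (tder fun t y => F t y * G t y) ≤
        C * (besovT χ (n / p) p (Set.Ioi 0) (tder F) * besovT χ s p (Set.Ioi 0) (tder G)) := by
  have hp1 : 1 ≤ p := by linarith
  obtain ⟨C, hC⟩ := χ.exists_besov_sprod_le (p := p) (s := s) hp (by simpa using hs)
    (by simpa using hs')
  simp only [finrank_euclideanSpace, Fintype.card_fin] at hC
  refine ⟨2 * C, fun F G hF hG => ?_⟩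
  set A := besovT χ (n / p) p (Set.Ioi 0) (tder F) with hA
  set B := besovT χ s p (Set.Ioi 0) (tder G) with hB
  have key : ∀ t, besov χ s p (tder (fun t y => F t y * G t y) t) ≤
      C * (besov χ (n / p) p (tder F t) * B) + C * (A * besov χ s p (tder G t)) := by
    intro t
    have h : tder (fun t y => F t y * G t y) t = (sprod (hF.tder.slice t) (hG.slice t) +
        sprod (hF.slice t) (hG.tder.slice t) : 𝓢(Euc n, ℂ)) := by
      ext y
      rw [hF.tder_mul hG, add_apply, sprod_apply, sprod_apply]
      rfl
    rw [h]
    refine (χ.besov_add_le s hp1 _ _).trans (add_le_add ((hC _ _).trans ?_) ((hC _ _).trans ?_))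
    · gcongr
      · exact le_rfl
      · exact hG.besov_le χ s hp1 t
    · gcongr
      · exact hF.besov_le χ _ hp1 t
      · exact le_rfl
  calc _ ≤ ∫⁻ t in Set.Ioi 0, (C * (besov χ (n / p) p (tder F t) * B) +
        C * (A * besov χ s p (tder G t))) := lintegral_mono key
    _ = C * (A * B) + C * (A * B) := by
      have m1 := hF.tder.measurable_besov χ (n / p) hp1
      have m2 := hG.tder.measurable_besov χ s hp1
      rw [lintegral_add_left ((m1.mul_const _).const_mul _),
        lintegral_const_mul _ (m1.mul_const _), lintegral_mul_const _ m1,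
        lintegral_const_mul _ (m2.const_mul _), lintegral_const_mul _ m2]
      rfl
    _ = _ := by
      push_cast
      ring

theorem besovT_tder_prod_pow_mul_le {p s : ℝ} {C : ℝ≥0∞}
    (hC : ∀ F G : ℝ → Euc n → ℂ, Tame F → Tame G →
      besovT χ s p (Set.Ioi 0) (tder fun t y => F t y * G t y) ≤
        C * (besovT χ (n / p) p (Set.Ioi 0) (tder F) * besovT χ s p (Set.Ioi 0) (tder G)))
    {ι : Type*} {W : ι → ℝ → Euc n → ℂ} (hW : ∀ v, Tame (W v)) {E : ℝ≥0∞}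
    (hE : ∀ v, besovT χ (n / p) p (Set.Ioi 0) (tder (W v)) ≤ E)
    {G : ℝ → Euc n → ℂ} (hG : Tame G) (S : Finset ι) (d : ι → ℕ) :
    Tame (fun t y => (∏ v ∈ S, W v t y ^ d v) * G t y) ∧
      besovT χ s p (Set.Ioi 0) (tder fun t y => (∏ v ∈ S, W v t y ^ d v) * G t y) ≤
        (C * E) ^ (∑ v ∈ S, d v) * besovT χ s p (Set.Ioi 0) (tder G) := by
  classical
  have hpow : ∀ (v : ι) {G : ℝ → Euc n → ℂ} (_ : Tame G) (k : ℕ),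
      Tame (fun t y => W v t y ^ k * G t y) ∧
      besovT χ s p (Set.Ioi 0) (tder fun t y => W v t y ^ k * G t y) ≤
        (C * E) ^ k * besovT χ s p (Set.Ioi 0) (tder G) := by
    intro v G hG k
    induction k with
    | zero => simpa using hG
    | succ k ih =>
      have h : (fun t y => W v t y ^ (k + 1) * G t y) =
          fun t y => W v t y * (W v t y ^ k * G t y) := by
        ext t y
        ring
      rw [h]
      refine ⟨(hW v).mul ih.1, (hC _ _ (hW v) ih.1).trans ?_⟩
      calc _ ≤ C * (E * ((C * E) ^ k * besovT χ s p (Set.Ioi 0) (tder G))) := by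
            gcongr
            · exact hE v
            · exact ih.2
        _ = _ := by ring
  induction S using Finset.induction_on with
  | empty => simpa using hG
  | insert a S ha ih =>
    have h : (fun t y => (∏ v ∈ insert a S, W v t y ^ d v) * G t y) =
        fun t y => W a t y ^ d a * ((∏ v ∈ S, W v t y ^ d v) * G t y) := by
      ext t y
      rw [Finset.prod_insert ha, mul_assoc]
    rw [h, Finset.sum_insert ha]
    obtain ⟨h1, h2⟩ := hpow a ih.1 (d a)
    refine ⟨h1, h2.trans ?_⟩
    rw [pow_add, mul_assoc]
    gcongr
    exact ih.2

end TimeDerivative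

section Smooth

variable {n : ℕ} (χ : LPF (Euc n))

namespace SmoothCpt

theorem component {u : ℝ → Euc n → Euc n} (hu : SmoothCpt n u) (m : Fin n) :
    SmoothCpt n fun t y => u t y m := by
  refine ⟨?_, ?_, fun t ht y => by simp [hu.2.2 t ht y]⟩
  · exact (EuclideanSpace.proj m : Euc n →L[ℝ] ℝ).contDiff.comp hu.1
  · exact hu.2.1.comp_left (g := fun z : Euc n => z m) rfl

variable {f : ℝ → Euc n → ℝ}

theorem pdv_eq (hf : SmoothCpt n f) (i : Fin n) (t : ℝ) (y : Euc n) :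
    pdv i (f t) y = fderiv ℝ (Function.uncurry f) (t, y) (0, EuclideanSpace.single i 1) := by
  have h1 : HasFDerivAt (Function.uncurry f) (fderiv ℝ (Function.uncurry f) (t, y)) (t, y) :=
    (hf.1.differentiable (by simp)).differentiableAt.hasFDerivAt
  have h2 : HasFDerivAt (f t) ((fderiv ℝ (Function.uncurry f) (t, y)).comp
      (ContinuousLinearMap.inr ℝ ℝ (Euc n))) y :=
    h1.comp y (hasFDerivAt_prodMk_right t y)
  rw [pdv, h2.fderiv]
  rfl

theorem pdv (hf : SmoothCpt n f) (i : Fin n) : SmoothCpt n fun t y => MHD.pdv i (f t) y := by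
  have h : (Function.uncurry fun t y => MHD.pdv i (f t) y) = fun q =>
      fderiv ℝ (Function.uncurry f) q ((0 : ℝ), EuclideanSpace.single i (1 : ℝ)) :=
    funext fun q => hf.pdv_eq i q.1 q.2
  refine ⟨?_, ?_, fun t ht y => ?_⟩
  · rw [h]
    exact (hf.1.fderiv_right (m := ∞) (by simp)).clm_apply contDiff_const
  · rw [h]
    exact hf.2.1.fderiv_apply (𝕜 := ℝ) _
  · have : f t = fun _ => 0 := funext fun z => hf.2.2 t ht z
    simp [MHD.pdv, this]

theorem exists_compact (hf : SmoothCpt n f) : ∃ (K : Set (Euc n)) (k : Set ℝ), IsCompact K ∧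
    IsCompact k ∧ (∀ t, ∀ y ∉ K, f t y = 0) ∧ ∀ y, ∀ t ∉ k, f t y = 0 := by
  have h : IsCompact (tsupport (Function.uncurry f)) := hf.2.1
  refine ⟨_, _, h.image continuous_snd, h.image continuous_fst, fun t y hy => ?_,
    fun y t ht => ?_⟩
  · by_contra h0
    exact hy ⟨(t, y), subset_tsupport _ h0, rfl⟩
  · by_contra h0
    exact ht ⟨(t, y), subset_tsupport _ h0, rfl⟩

theorem tame (hf : SmoothCpt n f) : Tame fun t y => (f t y : ℂ) := by
  obtain ⟨K, _, hK, _, hK', _⟩ := hf.exists_compact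
  exact ⟨Complex.ofRealCLM.contDiff.comp hf.1, fun t ht y => by simp [hf.2.2 t ht y],
    K, hK, fun t y hy => by simp [hK' t y hy]⟩

theorem tder_ofReal (hf : SmoothCpt n f) (t : ℝ) (y : Euc n) :
    tder (fun t y => (f t y : ℂ)) t y = ((deriv (fun τ => f τ y) t : ℝ) : ℂ) := by
  have h : DifferentiableAt ℝ (fun τ => f τ y) t :=
    ((hf.1.comp (contDiff_prodMk_left y)).differentiable (by simp)).differentiableAt
  exact h.hasDerivAt.ofReal_comp.deriv

theorem continuous_time (hf : SmoothCpt n f) (y : Euc n) : Continuous fun τ => f τ y :=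
  hf.1.continuous.comp (Continuous.prodMk_left y)

theorem contDiff_primitive (hf : SmoothCpt n f) :
    ContDiff ℝ ∞ (Function.uncurry fun (t : ℝ) (y : Euc n) => ∫ τ in (0 : ℝ)..t, f τ y) := by
  obtain ⟨_, k, _, hk, _, hk'⟩ := hf.exists_compact
  have h1 : LocallyIntegrable (Set.indicator (Set.Ici (0 : ℝ)) fun _ => (1 : ℝ)) volume :=
    (locallyIntegrable_const 1).indicator measurableSet_Ici
  have h2 := contDiffOn_convolution_left_with_param (𝕜 := ℝ) (n := ⊤) (μ := volume)
    (ContinuousLinearMap.mul ℝ ℝ) (g := fun (y : Euc n) (t : ℝ) => f t y)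
    isOpen_univ hk (fun y t _ ht => hk' y t ht) h1
    (hf.1.comp (contDiff_snd.prodMk contDiff_fst)).contDiffOn
  rw [Set.univ_prod_univ, contDiffOn_univ] at h2
  have h3 := h2.comp (contDiff_snd.prodMk contDiff_fst : ContDiff ℝ ∞ fun q : ℝ × Euc n =>
    (q.2, q.1))
  convert h3 using 1
  ext ⟨t, y⟩
  simp only [Function.uncurry_apply_pair, Function.comp_apply, convolution_def,
    ContinuousLinearMap.mul_apply']
  have h4 : ∀ τ : ℝ, f τ y * Set.indicator (Set.Ici (0 : ℝ)) (fun _ => (1 : ℝ)) (t - τ) =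
      Set.indicator (Set.Iic t) (fun τ => f τ y) τ := by
    intro τ
    by_cases h : τ ≤ t <;> simp [Set.indicator, h]
  simp only [h4]
  have h5 : ∀ s, s ≤ 0 → IntegrableOn (fun τ => f τ y) (Set.Iic s) := fun s hs =>
    (integrableOn_zero).congr_fun (fun τ hτ => (hf.2.2 τ (le_trans hτ hs) y).symm)
      measurableSet_Iic
  have h6 : ∀ s, s ≤ 0 → ∫ τ in Set.Iic s, f τ y = 0 := fun s hs =>
    setIntegral_eq_zero_of_forall_eq_zero fun τ hτ => hf.2.2 τ (le_trans hτ hs) y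
  have h7 : IntegrableOn (fun τ => f τ y) (Set.Iic t) := by
    have : HasCompactSupport fun τ => f τ y := HasCompactSupport.intro hk (hk' y)
    exact ((hf.continuous_time y).integrable_of_hasCompactSupport this).integrableOn
  rw [integral_indicator measurableSet_Iic,
    ← intervalIntegral.integral_Iic_sub_Iic (h5 0 le_rfl) h7, h6 0 le_rfl, sub_zero]

theorem tame_primitive (hf : SmoothCpt n f) :
    Tame fun t y => ((∫ τ in (0 : ℝ)..t, f τ y : ℝ) : ℂ) := by
  obtain ⟨K, _, hK, _, hK', _⟩ := hf.exists_compact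
  refine ⟨Complex.ofRealCLM.contDiff.comp hf.contDiff_primitive, fun t ht y => ?_,
    K, hK, fun t y hy => by simp [hK' _ y hy]⟩
  rw [intervalIntegral.integral_symm, intervalIntegral.integral_of_le ht,
    setIntegral_eq_zero_of_forall_eq_zero fun τ hτ => hf.2.2 τ hτ.2 y]
  simp

theorem tder_primitive (hf : SmoothCpt n f) :
    tder (fun t y => ((∫ τ in (0 : ℝ)..t, f τ y : ℝ) : ℂ)) = fun t y => (f t y : ℂ) := by
  ext t y
  have h : HasDerivAt (fun t => ∫ τ in (0 : ℝ)..t, f τ y) (f t y) t :=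
    ((hf.continuous_time y).integral_hasStrictDerivAt 0 t).hasDerivAt
  exact h.ofReal_comp.deriv

theorem pdv_ofReal (hf : SmoothCpt n f) (i : Fin n) (t : ℝ) (y : Euc n) :
    MHD.pdv i (fun z => (f t z : ℂ)) y = (MHD.pdv i (f t) y : ℝ) := by
  have h : DifferentiableAt ℝ (f t) y :=
    ((hf.1.comp (contDiff_prodMk_right t)).differentiable (by simp)).differentiableAt
  have := (Complex.ofRealCLM.hasFDerivAt.comp y h.hasFDerivAt).fderiv
  simp only [MHD.pdv]
  erw [this]
  rfl

end SmoothCpt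

theorem LPF.exists_besovT_le_pdv {p : ℝ} (hp : 1 ≤ p) (a : ℝ) :
    ∃ C : ℝ≥0, ∀ f : ℝ → Euc n → ℝ, SmoothCpt n f →
      besovT χ a p (Set.Ioi 0) (fun t y => (f t y : ℂ)) ≤
        C * ∑ i, besovT χ (a - 1) p (Set.Ioi 0) fun t y => ((pdv i (f t) y : ℝ) : ℂ) := by
  obtain ⟨C, hC⟩ := χ.exists_besov_le_sder hp a
  refine ⟨C, fun f hf => ?_⟩
  have hm : ∀ i, Measurable fun t => besov χ (a - 1) p fun y => ((pdv i (f t) y : ℝ) : ℂ) :=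
    fun i => (hf.pdv i).tame.measurable_besov χ (a - 1) hp
  simp only [besovT]
  rw [← lintegral_finsetSum _ fun i _ => hm i,
    ← lintegral_const_mul _ (Finset.measurable_sum _ fun i _ => hm i)]
  refine lintegral_mono fun t => ?_
  refine (hC (hf.tame.slice t)).trans_eq ?_
  congr 2 with i
  congr 1
  ext y
  exact (LPF.sder_apply _ _ _).trans (hf.pdv_ofReal i t y)

end Smooth

section Cofactor
variable {N : ℕ}

theorem totalDegree_adjugate_le (i j : Fin N) :
    (Matrix.adjugate (1 + Matrix.of fun a b => (MvPolynomial.X (a, b) :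
      MvPolynomial (Fin N × Fin N) ℝ)) i j).totalDegree ≤ N - 1 := by
  rw [Matrix.adjugate_apply, Matrix.det_apply]
  refine MvPolynomial.totalDegree_finsetSum_le fun σ _ => ?_
  refine (MvPolynomial.totalDegree_smul_le _ _).trans
    ((MvPolynomial.totalDegree_finsetProd _ _).trans ?_)
  calc _ ≤ ∑ a : Fin N, if σ a = j then 0 else 1 := by
        refine Finset.sum_le_sum fun a _ => ?_
        by_cases h : σ a = j
        · rw [h, Matrix.updateRow_self, if_pos rfl, Pi.single_apply]
          split_ifs <;> simp
        · rw [Matrix.updateRow_ne h, if_neg h, Matrix.add_apply, Matrix.of_apply,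
            Matrix.one_apply]
          refine (MvPolynomial.totalDegree_add _ _).trans ?_
          split_ifs <;> simp
    _ = N - 1 := by
        rw [Equiv.sum_comp σ fun a => if a = j then 0 else 1, Finset.sum_ite]
        simp [Finset.filter_ne']

theorem IsCofactorPoly.totalDegree_le {Q : Fin N → Fin N → MvPolynomial (Fin N × Fin N) ℝ}
    (hQ : IsCofactorPoly N Q) (i j : Fin N) : (Q i j).totalDegree ≤ N - 1 := by
  have h : Q i j = Matrix.adjugate (1 + Matrix.of fun a b => (MvPolynomial.X (a, b) :
      MvPolynomial (Fin N × Fin N) ℝ)) i j - MvPolynomial.C (if i = j then 1 else 0) := by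
    refine MvPolynomial.funext fun x => ?_
    have h1 := (hQ i j).2 (Matrix.of fun a b => x (a, b))
    have h2 : MvPolynomial.eval x (Matrix.adjugate (1 + Matrix.of fun a b => (MvPolynomial.X (a, b) :
        MvPolynomial (Fin N × Fin N) ℝ)) i j) =
        Matrix.adjugate (1 + Matrix.of fun a b => x (a, b)) i j := by
      have h3 := congrFun (congrFun (RingHom.map_adjugate (MvPolynomial.eval x)
        (1 + Matrix.of fun a b => (MvPolynomial.X (a, b) : MvPolynomial (Fin N × Fin N) ℝ))) i) j
      rw [RingHom.mapMatrix_apply, Matrix.map_apply] at h3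
      rw [h3, map_add, map_one]
      congr 2
      refine Matrix.ext fun a b => ?_
      simp
    rw [map_sub, h2, h1, MvPolynomial.eval_C]
    simp
  rw [h]
  refine (MvPolynomial.totalDegree_sub _ _).trans (max_le (totalDegree_adjugate_le i j) ?_)
  rw [MvPolynomial.totalDegree_C]
  exact Nat.zero_le _

theorem IsCofactorPoly.degree_mem {Q : Fin N → Fin N → MvPolynomial (Fin N × Fin N) ℝ}
    (hQ : IsCofactorPoly N Q) (i j : Fin N) {d : Fin N × Fin N →₀ ℕ} (hd : d ∈ (Q i j).support) :
    ∑ v, d v ∈ Finset.Icc 1 (N - 1) := by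
  rw [Finset.mem_Icc, Nat.one_le_iff_ne_zero]
  constructor
  · intro h0
    have : d = 0 := by
      ext v
      exact Finset.sum_eq_zero_iff.1 h0 v (Finset.mem_univ v)
    rw [this, MvPolynomial.mem_support_iff] at hd
    exact hd (hQ i j).1
  · refine le_trans (le_of_eq ?_) ((MvPolynomial.le_totalDegree hd).trans (hQ.totalDegree_le i j))
    exact (Finsupp.sum_fintype d (fun _ k => k) fun _ => rfl).symm

end Cofactor

theorem exists_Pu_bound (N : ℕ) (hN : 2 ≤ N) (p : ℝ) (hp1 : (N : ℝ) ≤ p) (hp2 : p < 2 * N - 1)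
    (χ : LPF (Euc N)) (Q : Fin N → Fin N → MvPolynomial (Fin N × Fin N) ℝ)
    (hQ : IsCofactorPoly N Q) (j : Fin N) :
    ∃ C : ℝ≥0, ∀ u : ℝ → Euc N → Euc N, SmoothCpt N u →
      besovT χ (-1 + N / p) p (Set.Ioi 0) (fun t y =>
          ((deriv (fun τ => ∑ i : Fin N, Pmat Q u τ y j i * u τ y i) t : ℝ) : ℂ)) ≤
        C * (∑ r ∈ Finset.Icc 1 (N - 1), EE χ (-1 + N / p) p u ^ r) *
          dtNorm χ (-1 + N / p) p u := by
  have hN' : (2 : ℝ) ≤ N := by exact_mod_cast hN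
  have hp0 : 0 < p := by linarith
  have hp : 1 ≤ p := by linarith
  have : Nontrivial (Euc N) := by
    have : Nonempty (Fin N) := ⟨⟨0, by omega⟩⟩
    infer_instance
  obtain ⟨C, hC⟩ := χ.exists_besovT_tder_mul_le (p := p) (s := -1 + N / p) (by linarith)
    (by linarith) (by
      have : 1 / 2 < (N : ℝ) / p := by
        rw [div_lt_div_iff₀ (by norm_num) hp0]
        linarith
      linarith)
  obtain ⟨κ, hκ⟩ := χ.exists_besovT_le_pdv hp (N / p)
  refine ⟨∑ i : Fin N, ∑ d ∈ (Q j i).support, ‖(Q j i).coeff d‖₊ * (C * κ) ^ (∑ v, d v),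
    fun u hu => ?_⟩
  set s : ℝ := -1 + N / p with hs
  set E := EE χ s p u with hE
  set W : Fin N × Fin N → ℝ → Euc N → ℂ := fun v t y =>
    ((∫ τ in (0 : ℝ)..t, pdv v.2 (fun z => u τ z v.1) y : ℝ) : ℂ) with hWdef
  set U : Fin N → ℝ → Euc N → ℂ := fun i t y => (u t y i : ℂ) with hUdef
  have hU : ∀ i, Tame (U i) := fun i => (hu.component i).tame
  have hW : ∀ v, Tame (W v) := fun v => ((hu.component v.1).pdv v.2).tame_primitive
  have hWE : ∀ v, besovT χ (N / p) p (Set.Ioi 0) (tder (W v)) ≤ κ * E := by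
    intro v
    rw [hWdef, ((hu.component v.1).pdv v.2).tder_primitive]
    refine (hκ _ ((hu.component v.1).pdv v.2)).trans ?_
    rw [show (N : ℝ) / p - 1 = s by ring]
    gcongr
    rw [hE, EE]
    refine le_trans ?_ (Finset.single_le_sum (fun _ _ => zero_le) (Finset.mem_univ v.1))
    refine Finset.sum_le_sum fun i _ => ?_
    exact Finset.single_le_sum (f := fun j => besovT χ s p (Set.Ioi 0)
      (fun t y => ((pdv i (pdv j fun z => u t z v.1) y : ℝ) : ℂ))) (fun _ _ => zero_le)
      (Finset.mem_univ v.2)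
  set M : (i : Fin N) → (Fin N × Fin N →₀ ℕ) → ℝ → Euc N → ℂ := fun i d t y =>
    (∏ v, W v t y ^ d v) * U i t y with hM
  have hMT := fun i (d : Fin N × Fin N →₀ ℕ) =>
    besovT_tder_prod_pow_mul_le χ hC hW hWE (hU i) Finset.univ d
  have hterm : ∀ i (d : Fin N × Fin N →₀ ℕ),
      Tame fun t y => (((Q j i).coeff d : ℝ) : ℂ) * M i d t y := fun i d => (hMT i d).1.const_mul _
  have hinner : ∀ i, Tame fun t y =>
      ∑ d ∈ (Q j i).support, (((Q j i).coeff d : ℝ) : ℂ) * M i d t y :=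
    fun i => Tame.sum fun d _ => hterm i d
  have hG : Tame fun t y => ∑ i, ∑ d ∈ (Q j i).support, (((Q j i).coeff d : ℝ) : ℂ) * M i d t y :=
    Tame.sum fun i _ => hinner i
  have hg : ∀ t y, ((∑ i : Fin N, Pmat Q u t y j i * u t y i : ℝ) : ℂ) =
      ∑ i, ∑ d ∈ (Q j i).support, (((Q j i).coeff d : ℝ) : ℂ) * M i d t y := by
    intro t y
    simp only [Pmat, MvPolynomial.eval_eq', hM, hWdef, hUdef]
    push_cast
    refine Finset.sum_congr rfl fun i _ => ?_
    rw [Finset.sum_mul]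
    exact Finset.sum_congr rfl fun d _ => mul_assoc _ _ _
  have hder : (fun t y => ((deriv (fun τ => ∑ i : Fin N, Pmat Q u τ y j i * u τ y i) t : ℝ) : ℂ)) =
      tder fun t y => ∑ i, ∑ d ∈ (Q j i).support, (((Q j i).coeff d : ℝ) : ℂ) * M i d t y := by
    ext t y
    have h1 := hG.hasDerivAt t y
    simp only [← hg] at h1 ⊢
    have h2 : HasDerivAt (fun τ => ∑ i : Fin N, Pmat Q u τ y j i * u τ y i)
        (tder (fun t y => ((∑ i : Fin N, Pmat Q u t y j i * u t y i : ℝ) : ℂ)) t y).re t := by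
      refine (Complex.reCLM.hasFDerivAt.comp_hasDerivAt t h1).congr_of_eventuallyEq ?_
      exact Eventually.of_forall fun τ => (Complex.ofReal_re _).symm
    rw [h2.deriv, ← h2.ofReal_comp.unique h1]
    simp
  have hdt : ∀ i, besovT χ s p (Set.Ioi 0) (tder (U i)) ≤ dtNorm χ s p u := by
    intro i
    have h : tder (U i) = fun t y => ((deriv (fun τ => u τ y i) t : ℝ) : ℂ) := by
      ext t y
      exact (hu.component i).tder_ofReal t y
    rw [h, dtNorm]
    exact Finset.single_le_sum (f := fun m => besovT χ s p (Set.Ioi 0)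
      (fun t y => ((deriv (fun τ => u τ y m) t : ℝ) : ℂ))) (fun _ _ => zero_le)
      (Finset.mem_univ i)
  rw [hder]
  refine (Tame.besovT_tder_sum_le χ (fun i _ => hinner i) s hp).trans ?_
  push_cast
  rw [Finset.sum_mul, Finset.sum_mul]
  refine Finset.sum_le_sum fun i _ => ?_
  refine (Tame.besovT_tder_sum_le χ (fun d _ => hterm i d) s hp).trans ?_
  rw [Finset.sum_mul, Finset.sum_mul]
  refine Finset.sum_le_sum fun d hd => ?_
  rw [(hMT i d).1.besovT_tder_const_mul χ _ s hp]
  calc _ ≤ ‖(((Q j i).coeff d : ℝ) : ℂ)‖ₑ * ((C * (κ * E)) ^ (∑ v, d v) * dtNorm χ s p u) := by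
        gcongr
        exact (hMT i d).2.trans (by gcongr; exact hdt i)
    _ = ‖(Q j i).coeff d‖₊ * (C * κ) ^ (∑ v, d v) * E ^ (∑ v, d v) * dtNorm χ s p u := by
        rw [← mul_assoc (C : ℝ≥0∞), mul_pow, ← mul_assoc, ← mul_assoc]
        congr 3
        rw [← enorm_eq_nnnorm, ← ofReal_norm, ← ofReal_norm, Complex.norm_real]
    _ ≤ _ := by
        gcongr
        exact Finset.single_le_sum (f := fun r => E ^ r) (fun _ _ => zero_le)
          (hQ.degree_mem j i hd)

end MHD

open MHD

noncomputable section

/-- **estimate (3.16).** For `N ≤ p < 2N − 1`, the field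
`g_j(t,y) = ∑_i P_{ji}(t,y) u_i(t,y)` satisfies
`‖∂_t g‖_{L¹(ℝ₊;Ḃ^{−1+N/p}_{p,1})}
  ≤ C (∑_{r=1}^{N−1} E(u)^r) ‖∂_t u‖_{L¹(ℝ₊;Ḃ^{−1+N/p}_{p,1})}`. -/
theorem Pu_time_derivative_estimate
    (N : ℕ) (hN : 2 ≤ N) (p : ℝ) (hp1 : (N : ℝ) ≤ p) (hp2 : p < 2 * N - 1)
    (χ : LPF (Euc N))
    (Q : Fin N → Fin N → MvPolynomial (Fin N × Fin N) ℝ) (hQ : IsCofactorPoly N Q) :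
    ∃ C : ℝ, 0 < C ∧
      ∀ u : ℝ → Euc N → Euc N, SmoothCpt N u →
        (∑ j : Fin N, besovT χ (-1 + N / p) p (Set.Ioi 0) (fun t y =>
          ((deriv (fun τ => ∑ i : Fin N, Pmat Q u τ y j i * u τ y i) t : ℝ) : ℂ))) ≤
        ENNReal.ofReal C *
          (∑ r ∈ Finset.Icc 1 (N - 1), EE χ (-1 + N / p) p u ^ r) *
          dtNorm χ (-1 + N / p) p u := by
  choose C hC using exists_Pu_bound N hN p hp1 hp2 χ Q hQ
  refine ⟨((∑ j, C j + 1 : NNReal) : ℝ), by positivity, fun u hu => ?_⟩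
  rw [ENNReal.ofReal_coe_nnreal]
  refine (Finset.sum_le_sum fun j _ => hC j u hu).trans ?_
  rw [← Finset.sum_mul, ← Finset.sum_mul]
  gcongr
  push_cast
  exact le_self_add
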